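/- arXiv:2209.01004 — 5 statements merged into one kernel-verified Lean document; each statement's English description precedes it below -/
import Mathlib

section
/- Let a0 ≤ b0 and a1 ≤ b1 be positive integers, for i = 0, 1 let G_i = K_{a_i, b_i} be the complete bipartite graph with parts of sizes a_i and b_i, and let n_i = a_i + b_i be its number of vertices. Then the pair ⟨G0, G1⟩ admits an MWG-drawing if and only if |n0 − n1| ≤ 2 and, for each i ∈ {0,1}, either a_i = 1 (G_i is a star K_{1, n_i − 1}) or a_i = 2 and b_i = 2 (G_i is K_{2,2}). -/
noncomputable section

/-- The Euclidean plane. -/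
abbrev Pt : Type := EuclideanSpace ℝ (Fin 2)

/-- The Gabriel disk `D[u,v]`: the closed disk having `u` and `v` as antipodal points. -/
def gabrielDisk (u v : Pt) : Set Pt := Metric.closedBall (midpoint ℝ u v) (dist u v / 2)

/-- `f` is a witness Gabriel drawing of the finite simple graph `G` with witness set `P`. -/
def IsWGDrawing {V : Type*} [Fintype V] (G : SimpleGraph V) (f : V → Pt) (P : Set Pt) : Prop :=
  Function.Injective f ∧ Disjoint (Set.range f) P ∧
    ∀ u v : V, u ≠ v → (G.Adj u v ↔ gabrielDisk (f u) (f v) ∩ P = ∅)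

/-- `⟨f₀, f₁⟩` is a mutual witness Gabriel drawing of the pair `⟨G₀, G₁⟩`. -/
def IsMWGDrawing {V₀ V₁ : Type*} [Fintype V₀] [Fintype V₁]
    (G₀ : SimpleGraph V₀) (G₁ : SimpleGraph V₁) (f₀ : V₀ → Pt) (f₁ : V₁ → Pt) : Prop :=
  Function.Injective f₀ ∧ Function.Injective f₁ ∧
    Disjoint (Set.range f₀) (Set.range f₁) ∧
    (∀ u v : V₀, u ≠ v → (G₀.Adj u v ↔ gabrielDisk (f₀ u) (f₀ v) ∩ Set.range f₁ = ∅)) ∧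
    (∀ u v : V₁, u ≠ v → (G₁.Adj u v ↔ gabrielDisk (f₁ u) (f₁ v) ∩ Set.range f₀ = ∅))

/-- Two subsets of the plane are linearly separable. -/
def LinSep (A B : Set Pt) : Prop :=
  ∃ (φ : Pt →ₗ[ℝ] ℝ) (c : ℝ), φ ≠ 0 ∧ (∀ a ∈ A, φ a < c) ∧ ∀ b ∈ B, c < φ b

namespace MutualWitness

/-- The inner product of `u - p` and `v - p`: nonpositive when `p` sees `u` and `v` at an angle
of at least `π / 2`. -/
def sight {R : Type*} [CommRing R] (p u v : R × R) : R :=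
  (u.1 - p.1) * (v.1 - p.1) + (u.2 - p.2) * (v.2 - p.2)

theorem sight_comm {R : Type*} [CommRing R] (p u v : R × R) : sight p u v = sight p v u := by
  simp only [sight]; ring

/-- The points `A` form a complete bipartite witness Gabriel drawing with parts given by `κ` and
witnesses `B`. -/
def Witnessed {R V W : Type*} [CommRing R] [LT R] (κ : V → Bool) (A : V → R × R)
    (B : W → R × R) : Prop :=
  ∀ u v, u ≠ v → (κ u ≠ κ v ↔ ∀ w, 0 < sight (B w) (A u) (A v))

/-- Coordinate form of a mutual witness Gabriel drawing of two complete bipartite graphs. -/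
structure Drawing {R V W : Type*} [CommRing R] [LT R] (κ : V → Bool) (μ : W → Bool)
    (A : V → R × R) (B : W → R × R) : Prop where
  injective_left : Function.Injective A
  injective_right : Function.Injective B
  ne : ∀ v w, A v ≠ B w
  left : Witnessed κ A B
  right : Witnessed μ B A

theorem Drawing.symm {R V W : Type*} [CommRing R] [LT R] {κ : V → Bool} {μ : W → Bool}
    {A : V → R × R} {B : W → R × R} (h : Drawing κ μ A B) : Drawing μ κ B A :=
  ⟨h.injective_right, h.injective_left, fun w v => (h.ne v w).symm, h.right, h.left⟩

section Geometry

theorem sight_pos_of_right_angle {p a b u v : ℝ × ℝ} (hab : sight p a b ≤ 0)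
    (hau : 0 < sight p a u) (hbu : 0 < sight p b u) (hav : 0 < sight p a v)
    (hbv : 0 < sight p b v) : 0 < sight p u v := by
  simp only [sight] at *
  generalize a.1 - p.1 = a1 at *
  generalize a.2 - p.2 = a2 at *
  generalize b.1 - p.1 = b1 at *
  generalize b.2 - p.2 = b2 at *
  generalize u.1 - p.1 = u1 at *
  generalize u.2 - p.2 = u2 at *
  generalize v.1 - p.1 = v1 at *
  generalize v.2 - p.2 = v2 at *
  have ha : 0 < a1 ^ 2 + a2 ^ 2 := by
    by_contra! h
    have h1 : a1 = 0 := by nlinarith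
    have h2 : a2 = 0 := by nlinarith
    simp [h1, h2] at hau
  set c := a1 * b2 - a2 * b1 with hc
  have hu : 0 < c * (a1 * u2 - a2 * u1) := by
    have : c * (a1 * u2 - a2 * u1) = (b1 * u1 + b2 * u2) * (a1 ^ 2 + a2 ^ 2)
        - (a1 * b1 + a2 * b2) * (a1 * u1 + a2 * u2) := by rw [hc]; ring
    nlinarith [mul_pos hbu ha]
  have hv : 0 < c * (a1 * v2 - a2 * v1) := by
    have : c * (a1 * v2 - a2 * v1) = (b1 * v1 + b2 * v2) * (a1 ^ 2 + a2 ^ 2)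
        - (a1 * b1 + a2 * b2) * (a1 * v1 + a2 * v2) := by rw [hc]; ring
    nlinarith [mul_pos hbv ha]
  have hc2 : 0 < c ^ 2 := by
    have : c ≠ 0 := by rintro h; simp [h] at hu
    positivity
  have key : (u1 * v1 + u2 * v2) * (a1 ^ 2 + a2 ^ 2) * c ^ 2 =
      (a1 * u1 + a2 * u2) * (a1 * v1 + a2 * v2) * c ^ 2
        + (c * (a1 * u2 - a2 * u1)) * (c * (a1 * v2 - a2 * v1)) := by ring
  have : 0 < (u1 * v1 + u2 * v2) * ((a1 ^ 2 + a2 ^ 2) * c ^ 2) := by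
    rw [← mul_assoc, key]; positivity
  exact pos_of_mul_pos_left this (by positivity)

/-- The segments `uv` and `pq` have a point in common. -/
def Crosses (u v p q : ℝ × ℝ) : Prop :=
  ∃ s t : ℝ, 0 ≤ s ∧ s ≤ 1 ∧ 0 ≤ t ∧ t ≤ 1 ∧
    (1 - s) * u.1 + s * v.1 = (1 - t) * p.1 + t * q.1 ∧
    (1 - s) * u.2 + s * v.2 = (1 - t) * p.2 + t * q.2

theorem Crosses.symm {u v p q : ℝ × ℝ} (h : Crosses u v p q) : Crosses p q u v := by
  obtain ⟨s, t, h1, h2, h3, h4, h5, h6⟩ := h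
  exact ⟨t, s, h3, h4, h1, h2, h5.symm, h6.symm⟩

/-- A quadrilateral with crossing diagonals has an angle of at least `π / 2`. -/
theorem Crosses.not_acute {u v p q : ℝ × ℝ} (h : Crosses u v p q) (hp : 0 < sight p u v)
    (hq : 0 < sight q u v) (hu : 0 < sight u p q) (hv : 0 < sight v p q) : False := by
  obtain ⟨s, t, hs0, hs1, ht0, ht1, h1, h2⟩ := h
  simp only [sight] at *
  have comb : ∀ r x y : ℝ, 0 ≤ r → r ≤ 1 → 0 < x → 0 < y → 0 < (1 - r) * x + r * y := by
    intro r x y h0 h1 hx hy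
    rcases h0.eq_or_lt with rfl | h0
    · simpa using hx
    · have := mul_pos h0 hy
      have := mul_nonneg (sub_nonneg.2 h1) hx.le
      linarith
  have e1 := comb t _ _ ht0 ht1 hp hq
  have e2 := comb s _ _ hs0 hs1 hu hv
  set o1 := (1 - s) * u.1 + s * v.1 with ho1
  set o2 := (1 - s) * u.2 + s * v.2 with ho2
  have f1 : (1 - t) * ((u.1 - p.1) * (v.1 - p.1) + (u.2 - p.2) * (v.2 - p.2))
      + t * ((u.1 - q.1) * (v.1 - q.1) + (u.2 - q.2) * (v.2 - q.2))
      = -(s * (1 - s)) * ((u.1 - v.1) ^ 2 + (u.2 - v.2) ^ 2)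
        + t * (1 - t) * ((p.1 - q.1) ^ 2 + (p.2 - q.2) ^ 2) := by
    linear_combination (u.1 + v.1 - (1 - s) * u.1 - s * v.1 - (1 - t) * p.1 - t * q.1) * h1
      + (u.2 + v.2 - (1 - s) * u.2 - s * v.2 - (1 - t) * p.2 - t * q.2) * h2
  have f2 : (1 - s) * ((p.1 - u.1) * (q.1 - u.1) + (p.2 - u.2) * (q.2 - u.2))
      + s * ((p.1 - v.1) * (q.1 - v.1) + (p.2 - v.2) * (q.2 - v.2))
      = (s * (1 - s)) * ((u.1 - v.1) ^ 2 + (u.2 - v.2) ^ 2)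
        - t * (1 - t) * ((p.1 - q.1) ^ 2 + (p.2 - q.2) ^ 2) := by
    linear_combination (-(p.1 + q.1) + (1 - s) * u.1 + s * v.1 + (1 - t) * p.1 + t * q.1) * h1
      + (-(p.2 + q.2) + (1 - s) * u.2 + s * v.2 + (1 - t) * p.2 + t * q.2) * h2
  linarith

theorem exists_zero_mem_unitInterval {x y : ℝ} (h : x * y ≤ 0) :
    ∃ s : ℝ, 0 ≤ s ∧ s ≤ 1 ∧ (1 - s) * x + s * y = 0 := by
  by_cases hx : x = 0
  · exact ⟨0, le_rfl, zero_le_one, by simp [hx]⟩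
  · have hne : x - y ≠ 0 := by
      intro h0
      have : y = x := by linarith
      subst this
      exact hx (by nlinarith)
    refine ⟨x / (x - y), ?_, ?_, by field_simp; ring⟩
    · rw [← mul_div_mul_right _ _ hne]
      exact div_nonneg (by nlinarith [sq_nonneg x]) (mul_self_nonneg _)
    · rw [← sub_nonneg, one_sub_div hne, ← mul_div_mul_right _ _ hne]
      exact div_nonneg (by nlinarith [sq_nonneg y]) (mul_self_nonneg _)

theorem crosses_of_opposite_sides {p q x u : ℝ × ℝ}
    (hside : ((q.1 - p.1) * (x.2 - p.2) - (q.2 - p.2) * (x.1 - p.1)) *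
      ((q.1 - p.1) * (u.2 - p.2) - (q.2 - p.2) * (u.1 - p.1)) ≤ 0)
    (hp : 0 < sight p x u) (hq : 0 < sight q x u) (hpx : 0 < sight p q x)
    (hqx : 0 < sight q p x) : Crosses x u p q := by
  obtain ⟨s, hs0, hs1, hs⟩ := exists_zero_mem_unitInterval hside
  simp only [sight] at *
  set e1 := q.1 - p.1 with he1
  set e2 := q.2 - p.2 with he2
  set X1 := x.1 - p.1 with hX1
  set X2 := x.2 - p.2 with hX2
  set U1 := u.1 - p.1 with hU1
  set U2 := u.2 - p.2 with hU2
  have hE : 0 < e1 ^ 2 + e2 ^ 2 := by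
    by_contra! h
    have h1 : e1 = 0 := by nlinarith
    have h2 : e2 = 0 := by nlinarith
    simp [h1, h2] at hpx
  set O1 := (1 - s) * X1 + s * U1 with hO1
  set O2 := (1 - s) * X2 + s * U2 with hO2
  have hO : e1 * O2 - e2 * O1 = 0 := by rw [hO1, hO2, ← hs]; ring
  set t := (O1 * e1 + O2 * e2) / (e1 ^ 2 + e2 ^ 2) with ht
  have ht1 : O1 = t * e1 := by
    rw [ht]; field_simp; linear_combination (-e2) * hO
  have ht2 : O2 = t * e2 := by
    rw [ht]; field_simp; linear_combination e1 * hO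
  have hr : 0 ≤ 1 - s := sub_nonneg.2 hs1
  refine ⟨s, t, hs0, hs1, ?_, ?_, ?_, ?_⟩
  · by_contra! h
    have h3 : t * (e1 * X1 + e2 * X2) = (1 - s) * (X1 ^ 2 + X2 ^ 2)
        + s * (X1 * U1 + X2 * U2) := by
      linear_combination (-X1) * ht1 + (-X2) * ht2 + X1 * hO1 + X2 * hO2
    linarith [mul_neg_of_neg_of_pos h hpx, mul_nonneg hs0 hp.le,
      mul_nonneg hr (add_nonneg (sq_nonneg X1) (sq_nonneg X2))]
  · by_contra! h
    have h3 : (t - 1) * (e1 * (X1 - e1) + e2 * (X2 - e2)) =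
        (1 - s) * ((X1 - e1) ^ 2 + (X2 - e2) ^ 2)
        + s * ((X1 - e1) * (U1 - e1) + (X2 - e2) * (U2 - e2)) := by
      linear_combination (-(X1 - e1)) * ht1 + (-(X2 - e2)) * ht2 + (X1 - e1) * hO1
        + (X2 - e2) * hO2
    have h4 : e1 * (X1 - e1) + e2 * (X2 - e2) < 0 := by
      rw [he1, he2, hX1, hX2]; linarith
    have h5 : 0 < (X1 - e1) * (U1 - e1) + (X2 - e2) * (U2 - e2) := by
      rw [he1, he2, hX1, hX2, hU1, hU2]; linarith
    linarith [mul_neg_of_pos_of_neg (sub_pos.2 h) h4, mul_nonneg hs0 h5.le,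
      mul_nonneg hr (add_nonneg (sq_nonneg (X1 - e1)) (sq_nonneg (X2 - e2)))]
  · linear_combination ht1
  · linear_combination ht2

/-- If the segments `uv` and `pq` cross and `x` makes acute angles with `u` and `v` at both `p` and
`q`, then one of the segments `xu`, `xv` crosses `pq` too. -/
theorem Crosses.exists_crosses {u v p q x : ℝ × ℝ} (h : Crosses u v p q)
    (hpu : 0 < sight p x u) (hpv : 0 < sight p x v) (hqu : 0 < sight q x u)
    (hqv : 0 < sight q x v) : Crosses x u p q ∨ Crosses x v p q := by
  obtain ⟨s, t, hs0, hs1, ht0, ht1, h1, h2⟩ := h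
  have hr : 0 ≤ 1 - s := sub_nonneg.2 hs1
  have hr' : 0 ≤ 1 - t := sub_nonneg.2 ht1
  have comb : ∀ x y : ℝ, 0 < x → 0 < y → 0 < (1 - s) * x + s * y := by
    intro x y hx hy
    rcases hs0.eq_or_lt with rfl | h0
    · simpa using hx
    · have := mul_pos h0 hy
      have := mul_nonneg hr hx.le
      linarith
  have hpx : 0 < sight p q x := by
    have := comb _ _ hpu hpv
    have e : (1 - s) * sight p x u + s * sight p x v = t * sight p q x := by
      simp only [sight]
      linear_combination (x.1 - p.1) * h1 + (x.2 - p.2) * h2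
    exact pos_of_mul_pos_right (e ▸ this) ht0
  have hqx : 0 < sight q p x := by
    have := comb _ _ hqu hqv
    have e : (1 - s) * sight q x u + s * sight q x v = (1 - t) * sight q p x := by
      simp only [sight]
      linear_combination (x.1 - q.1) * h1 + (x.2 - q.2) * h2
    exact pos_of_mul_pos_right (e ▸ this) hr'
  by_cases hu : ((q.1 - p.1) * (x.2 - p.2) - (q.2 - p.2) * (x.1 - p.1)) *
      ((q.1 - p.1) * (u.2 - p.2) - (q.2 - p.2) * (u.1 - p.1)) ≤ 0
  · exact Or.inl (crosses_of_opposite_sides hu hpu hqu hpx hqx)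
  · refine Or.inr (crosses_of_opposite_sides ?_ hpv hqv hpx hqx)
    by_contra! hv
    push Not at hu
    have := comb _ _ hu hv
    refine this.ne' ?_
    linear_combination ((q.1 - p.1) * (x.2 - p.2) - (q.2 - p.2) * (x.1 - p.1)) *
      ((q.1 - p.1) * h2 - (q.2 - p.2) * h1)

end Geometry

/-- Kirchberger's theorem in the plane: if the convex hulls of `s` and `t` meet, then a point of one
set lies in the convex hull of the other, or two segments spanned by them cross. -/
theorem exists_crosses_of_mem_convexHull {s t : Set (ℝ × ℝ)} {o : ℝ × ℝ}
    (hs : o ∈ convexHull ℝ s) (ht : o ∈ convexHull ℝ t) :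
    (∃ a ∈ s, a ∈ convexHull ℝ t) ∨ (∃ b ∈ t, b ∈ convexHull ℝ s) ∨
      ∃ a ∈ s, ∃ a' ∈ s, ∃ b ∈ t, ∃ b' ∈ t, Crosses a a' b b' := by
  let f : (ℝ × ℝ) →ᵃ[ℝ] (ℝ × ℝ) × ℝ :=
    (LinearMap.inl ℝ (ℝ × ℝ) ℝ).toAffineMap + AffineMap.const ℝ _ ((0 : ℝ × ℝ), (1 : ℝ))
  let g : (ℝ × ℝ) →ᵃ[ℝ] (ℝ × ℝ) × ℝ := -f
  have hf : ∀ z, f z = (z, 1) := fun z => by simp [f]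
  have hg : ∀ z, g z = (-z, -1) := fun z => by simp [g, hf]
  have h1 : f o ∈ convexHull ℝ (f '' s ∪ g '' t) := by
    refine convexHull_mono Set.subset_union_left ?_
    rw [← AffineMap.image_convexHull]
    exact Set.mem_image_of_mem _ hs
  have h2 : g o ∈ convexHull ℝ (f '' s ∪ g '' t) := by
    refine convexHull_mono Set.subset_union_right ?_
    rw [← AffineMap.image_convexHull]
    exact Set.mem_image_of_mem _ ht
  have h0 : (0 : (ℝ × ℝ) × ℝ) ∈ convexHull ℝ (f '' s ∪ g '' t) := by
    have := (convex_convexHull ℝ (f '' s ∪ g '' t)) h1 h2 (by norm_num : (0 : ℝ) ≤ 1 / 2)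
      (by norm_num : (0 : ℝ) ≤ 1 / 2) (by norm_num)
    have e : g o = -f o := rfl
    simpa [e] using this
  obtain ⟨ι, _, z, w, hz, hind, hw, hw1, hwz⟩ := eq_pos_convex_span_of_mem_convexHull h0
  classical
  let I : Finset ι := Finset.univ.filter fun i => (z i).2 = 1
  let J : Finset ι := Finset.univ.filter fun i => ¬ (z i).2 = 1
  have hI : ∀ i ∈ I, (z i).1 ∈ s ∧ (z i).2 = 1 := by
    intro i hi
    have hi1 : (z i).2 = 1 := (Finset.mem_filter.1 hi).2
    rcases hz ⟨i, rfl⟩ with ⟨a, ha, e⟩ | ⟨a, ha, e⟩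
    · rw [← e, hf]; exact ⟨ha, rfl⟩
    · rw [← e, hg] at hi1; norm_num at hi1
  have hJ : ∀ i ∈ J, -(z i).1 ∈ t ∧ (z i).2 = -1 := by
    intro i hi
    have hi1 : ¬ (z i).2 = 1 := (Finset.mem_filter.1 hi).2
    rcases hz ⟨i, rfl⟩ with ⟨a, ha, e⟩ | ⟨a, ha, e⟩
    · rw [← e, hf] at hi1; simp at hi1
    · rw [← e, hg]; simpa using ha
  have hsplit : ∀ {M : Type} [AddCommMonoid M] (F : ι → M),
      ∑ i ∈ I, F i + ∑ i ∈ J, F i = ∑ i, F i := fun F =>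
    Finset.sum_filter_add_sum_filter_not _ _ _
  have hcard : I.card + J.card ≤ 4 := by
    have e := Finset.card_filter_add_card_filter_not (s := (Finset.univ : Finset ι))
      (fun i => (z i).2 = 1)
    have h3 := hind.card_le_finrank_succ
    have h4 := Submodule.finrank_le (vectorSpan ℝ (Set.range z))
    have h5 : Module.finrank ℝ ((ℝ × ℝ) × ℝ) = 3 := by simp
    rw [Finset.card_univ] at e
    change I.card + J.card = _ at e
    omega
  have hsum2 : ∑ i ∈ I, w i - ∑ i ∈ J, w i = 0 := by
    have := congrArg Prod.snd hwz
    rw [Prod.snd_sum, ← hsplit] at this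
    rw [Finset.sum_congr rfl (g := w) fun i hi => by simp [(hI i hi).2],
      Finset.sum_congr rfl (s₁ := J) (g := fun i => -w i) fun i hi => by simp [(hJ i hi).2],
      Finset.sum_neg_distrib] at this
    simpa [sub_eq_add_neg] using this
  have hsum1 : ∑ i ∈ I, w i + ∑ i ∈ J, w i = 1 := by rw [hsplit, hw1]
  have hIw : ∑ i ∈ I, 2 * w i = 1 := by rw [← Finset.mul_sum]; linarith
  have hJw : ∑ i ∈ J, 2 * w i = 1 := by rw [← Finset.mul_sum]; linarith
  have hpt : ∑ i ∈ I, (2 * w i) • (z i).1 = ∑ i ∈ J, (2 * w i) • (-(z i).1) := by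
    have := congrArg Prod.fst hwz
    rw [Prod.fst_sum, ← hsplit] at this
    simp only [mul_smul, smul_neg, Finset.sum_neg_distrib, ← Finset.smul_sum]
    rw [← smul_neg]
    congr 1
    exact eq_neg_of_add_eq_zero_left this
  have hpos : ∀ i, 0 ≤ 2 * w i := fun i => by linarith [hw i]
  have hmemI : ∑ i ∈ I, (2 * w i) • (z i).1 ∈ convexHull ℝ s :=
    (convex_convexHull ℝ s).sum_mem (fun i _ => hpos i) hIw
      fun i hi => subset_convexHull ℝ s (hI i hi).1
  have hmemJ : ∑ i ∈ J, (2 * w i) • (-(z i).1) ∈ convexHull ℝ t :=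
    (convex_convexHull ℝ t).sum_mem (fun i _ => hpos i) hJw
      fun i hi => subset_convexHull ℝ t (hJ i hi).1
  have hI0 : I.card ≠ 0 := by
    intro h; simp [Finset.card_eq_zero.1 h] at hIw
  have hJ0 : J.card ≠ 0 := by
    intro h; simp [Finset.card_eq_zero.1 h] at hJw
  by_cases hI1 : I.card = 1
  · obtain ⟨i, hi⟩ := Finset.card_eq_one.1 hI1
    refine Or.inl ⟨(z i).1, (hI i (by simp [hi])).1, ?_⟩
    rw [← hpt] at hmemJ
    rw [hi, Finset.sum_singleton] at hIw hmemJ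
    simpa [hIw] using hmemJ
  by_cases hJ1 : J.card = 1
  · obtain ⟨j, hj⟩ := Finset.card_eq_one.1 hJ1
    refine Or.inr (Or.inl ⟨-(z j).1, (hJ j (by simp [hj])).1, ?_⟩)
    rw [hpt] at hmemI
    rw [hj, Finset.sum_singleton] at hJw hmemI
    simpa [hJw] using hmemI
  obtain ⟨i, i', hii, hi⟩ := Finset.card_eq_two.1 (by omega : I.card = 2)
  obtain ⟨j, j', hjj, hj⟩ := Finset.card_eq_two.1 (by omega : J.card = 2)
  refine Or.inr (Or.inr ⟨(z i).1, (hI i (by simp [hi])).1, (z i').1, (hI i' (by simp [hi])).1,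
    -(z j).1, (hJ j (by simp [hj])).1, -(z j').1, (hJ j' (by simp [hj])).1,
    2 * w i', 2 * w j', hpos _, ?_, hpos _, ?_, ?_, ?_⟩)
  all_goals rw [hi, Finset.sum_pair hii] at hIw
  all_goals rw [hj, Finset.sum_pair hjj] at hJw
  · linarith [hpos i]
  · linarith [hpos j]
  all_goals rw [hi, hj, Finset.sum_pair hii, Finset.sum_pair hjj] at hpt
  · have := congrArg Prod.fst hpt
    simp only [Prod.fst_add, Prod.smul_fst, Prod.fst_neg, smul_eq_mul] at this ⊢
    linear_combination this - (z i).1.1 * hIw - (z j).1.1 * hJw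
  · have := congrArg Prod.snd hpt
    simp only [Prod.snd_add, Prod.smul_snd, Prod.snd_neg, smul_eq_mul] at this ⊢
    linear_combination this - (z i).1.2 * hIw - (z j).1.2 * hJw

section Separation

variable {V W : Type*} {κ : V → Bool} {μ : W → Bool} {A : V → ℝ × ℝ} {B : W → ℝ × ℝ}

theorem exists_other_part (hκ : Function.Surjective κ) (u : V) : ∃ x, κ x ≠ κ u := by
  obtain ⟨x, hx⟩ := hκ (!κ u)
  exact ⟨x, by simp [hx]⟩

theorem Witnessed.pos (h : Witnessed κ A B) {u v : V} (huv : κ u ≠ κ v) (w : W) :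
    0 < sight (B w) (A u) (A v) :=
  (h u v fun e => huv (e ▸ rfl)).1 huv w

theorem Witnessed.exists_witness (h : Witnessed κ A B) {u v : V} (hne : u ≠ v)
    (huv : κ u = κ v) : ∃ w, sight (B w) (A u) (A v) ≤ 0 := by
  by_contra! hw
  exact (h u v hne).2 hw huv

theorem sight_self_pos {p u : ℝ × ℝ} (h : u ≠ p) : 0 < sight p u u := by
  simp only [sight]
  by_contra! h0
  refine h (Prod.ext ?_ ?_)
  · nlinarith [mul_self_nonneg (u.1 - p.1), mul_self_nonneg (u.2 - p.2)]
  · nlinarith [mul_self_nonneg (u.1 - p.1), mul_self_nonneg (u.2 - p.2)]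

theorem Drawing.same_of_sight (h : Drawing κ μ A B) {u v : V} {w : W}
    (huv : sight (B w) (A u) (A v) ≤ 0) : κ u = κ v := by
  by_contra hne
  exact huv.not_gt (h.left.pos hne w)

/-- A witness that sees a pair in one part at a right or obtuse angle sees all pairs in the other
part at acute angles. -/
theorem Drawing.sight_pos_of_other (h : Drawing κ μ A B) {u v x y : V} {w : W}
    (huv : sight (B w) (A u) (A v) ≤ 0) (hx : κ u ≠ κ x) (hy : κ u ≠ κ y) :
    0 < sight (B w) (A x) (A y) := by
  have e := h.same_of_sight huv
  exact sight_pos_of_right_angle huv (h.left.pos hx w) (h.left.pos (e ▸ hx) w)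
    (h.left.pos hy w) (h.left.pos (e ▸ hy) w)

theorem Drawing.exists_forall_sight_pos (h : Drawing κ μ A B) (hκ : Function.Surjective κ)
    (w : W) : ∃ u, ∀ v, 0 < sight (B w) (A u) (A v) := by
  by_cases hw : ∃ u v, sight (B w) (A u) (A v) ≤ 0
  · obtain ⟨u, v, huv⟩ := hw
    obtain ⟨x, hx⟩ := exists_other_part hκ u
    refine ⟨x, fun y => ?_⟩
    by_cases hy : κ u = κ y
    · exact h.left.pos (hy ▸ hx) w
    · exact h.sight_pos_of_other huv hx.symm hy
  · push Not at hw
    obtain ⟨u, -⟩ := hκ true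
    exact ⟨u, hw u⟩

theorem Drawing.not_mem_convexHull (h : Drawing κ μ A B) (hκ : Function.Surjective κ) (w : W) :
    B w ∉ convexHull ℝ (Set.range A) := by
  obtain ⟨u, hu⟩ := h.exists_forall_sight_pos hκ w
  intro hmem
  have hconv : Convex ℝ {x | 0 < sight (B w) (A u) x} := by
    intro x hx y hy a b ha hb hab
    simp only [Set.mem_ofPred_eq] at *
    have e : sight (B w) (A u) (a • x + b • y) =
        a * sight (B w) (A u) x + b * sight (B w) (A u) y := by
      obtain rfl : b = 1 - a := by linarith
      simp [sight]; ring
    rw [e]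
    rcases ha.eq_or_lt with rfl | ha
    · obtain rfl : b = 1 := by linarith
      simpa using hy
    · linarith [mul_pos ha hx, mul_nonneg hb hy.le]
  have := convexHull_min (s := Set.range A) (by rintro _ ⟨v, rfl⟩; exact hu v) hconv hmem
  simp [sight] at this

theorem Drawing.not_crosses_of_adj (h : Drawing κ μ A B) (hμ : Function.Surjective μ) {u v : V}
    (huv : κ u ≠ κ v) (p q : W) : ¬ Crosses (A u) (A v) (B p) (B q) := by
  intro hc
  have hpq : μ p = μ q := by
    by_contra hne
    exact hc.not_acute (h.left.pos huv _) (h.left.pos huv _) (h.right.pos hne _)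
      (h.right.pos hne _)
  obtain ⟨y, hyp⟩ := exists_other_part hμ p
  have hyq : μ y ≠ μ q := hpq ▸ hyp
  rcases hc.symm.exists_crosses (h.right.pos hyp u) (h.right.pos hyq u) (h.right.pos hyp v)
    (h.right.pos hyq v) with hc' | hc'
  · exact hc'.not_acute (h.right.pos hyp _) (h.right.pos hyp _) (h.left.pos huv _)
      (h.left.pos huv _)
  · exact hc'.not_acute (h.right.pos hyq _) (h.right.pos hyq _) (h.left.pos huv _)
      (h.left.pos huv _)

theorem Drawing.not_crosses (h : Drawing κ μ A B) (hκ : Function.Surjective κ)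
    (hμ : Function.Surjective μ) (u v : V) (p q : W) :
    ¬ Crosses (A u) (A v) (B p) (B q) := by
  intro hc
  by_cases huv : κ u = κ v
  · obtain ⟨x, hxu⟩ := exists_other_part hκ u
    have hxv : κ x ≠ κ v := huv ▸ hxu
    rcases hc.exists_crosses (h.left.pos hxu p) (h.left.pos hxv p) (h.left.pos hxu q)
      (h.left.pos hxv q) with hc' | hc'
    · exact h.not_crosses_of_adj hμ hxu p q hc'
    · exact h.not_crosses_of_adj hμ hxv p q hc'
  · exact h.not_crosses_of_adj hμ huv p q hc

/-- The two point sets of a drawing are separated by a line. -/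
theorem Drawing.exists_separating [Finite V] [Finite W] (h : Drawing κ μ A B)
    (hκ : Function.Surjective κ) (hμ : Function.Surjective μ) :
    ∃ n : ℝ × ℝ, ∀ v w, n.1 * (A v).1 + n.2 * (A v).2 < n.1 * (B w).1 + n.2 * (B w).2 := by
  have hdisj : Disjoint (convexHull ℝ (Set.range A)) (convexHull ℝ (Set.range B)) := by
    rw [Set.disjoint_left]
    intro o ho ho'
    rcases exists_crosses_of_mem_convexHull ho ho' with
      ⟨_, ⟨v, rfl⟩, hv⟩ | ⟨_, ⟨w, rfl⟩, hw⟩ | ⟨_, ⟨u, rfl⟩, _, ⟨v, rfl⟩, _, ⟨p, rfl⟩, _, ⟨q, rfl⟩, hc⟩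
    · exact h.symm.not_mem_convexHull hμ v hv
    · exact h.not_mem_convexHull hκ w hw
    · exact h.not_crosses hκ hμ u v p q hc
  obtain ⟨f, a, b, ha, hab, hb⟩ := geometric_hahn_banach_compact_closed
    (convex_convexHull ℝ (Set.range A)) ((Set.finite_range A).isCompact_convexHull (𝕜 := ℝ))
    (convex_convexHull ℝ (Set.range B))
    ((Set.finite_range B).isCompact_convexHull (𝕜 := ℝ)).isClosed hdisj
  have hf : ∀ z : ℝ × ℝ, f (1, 0) * z.1 + f (0, 1) * z.2 = f z := by
    intro z
    have e : z = z.1 • ((1 : ℝ), (0 : ℝ)) + z.2 • ((0 : ℝ), (1 : ℝ)) := by ext <;> simp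
    conv_rhs => rw [e, map_add, map_smul, map_smul, smul_eq_mul, smul_eq_mul]
    ring
  refine ⟨(f (1, 0), f (0, 1)), fun v w => ?_⟩
  simp only [hf]
  exact (ha _ (subset_convexHull ℝ _ ⟨v, rfl⟩)).trans
    (hab.trans (hb _ (subset_convexHull ℝ _ ⟨w, rfl⟩)))

/-- A drawing can be rotated and scaled so that the separating line becomes horizontal. -/
theorem Drawing.exists_horizontal [Finite V] [Finite W] (h : Drawing κ μ A B)
    (hκ : Function.Surjective κ) (hμ : Function.Surjective μ) :
    ∃ (A' : V → ℝ × ℝ) (B' : W → ℝ × ℝ), Drawing κ μ A' B' ∧ ∀ v w, (A' v).2 < (B' w).2 := by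
  obtain ⟨n, hn⟩ := h.exists_separating hκ hμ
  let F : ℝ × ℝ → ℝ × ℝ := fun z => (n.2 * z.1 - n.1 * z.2, n.1 * z.1 + n.2 * z.2)
  have hN : 0 < n.1 ^ 2 + n.2 ^ 2 := by
    by_contra! h0
    have h1 : n.1 = 0 := by nlinarith
    have h2 : n.2 = 0 := by nlinarith
    obtain ⟨v, -⟩ := hκ true
    obtain ⟨w, -⟩ := hμ true
    simpa [h1, h2] using hn v w
  have hF : ∀ p u v, sight (F p) (F u) (F v) = (n.1 ^ 2 + n.2 ^ 2) * sight p u v := by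
    intro p u v; simp only [sight, F]; ring
  have hpos : ∀ p u v, 0 < sight (F p) (F u) (F v) ↔ 0 < sight p u v := by
    intro p u v; rw [hF, mul_pos_iff_of_pos_left hN]
  have hinj : Function.Injective F := by
    intro x y hxy
    by_contra hne
    have h1 := (hpos y x x).2 (sight_self_pos hne)
    rw [hxy] at h1
    simp [sight] at h1
  refine ⟨F ∘ A, F ∘ B, ⟨hinj.comp h.injective_left, hinj.comp h.injective_right,
    fun v w e => h.ne v w (hinj e), fun u v huv => ?_, fun u v huv => ?_⟩, hn⟩
  · simpa only [Function.comp_apply, hpos] using h.left u v huv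
  · simpa only [Function.comp_apply, hpos] using h.right u v huv

end Separation

section Horizontal

theorem lt_and_lt_of_sight_nonpos {p u v : ℝ × ℝ} (hu : u.2 < p.2) (hv : v.2 < p.2)
    (h : sight p u v ≤ 0) (huv : u.1 ≤ v.1) : u.1 < p.1 ∧ p.1 < v.1 := by
  simp only [sight] at h
  have h1 := mul_pos_of_neg_of_neg (sub_neg.2 hu) (sub_neg.2 hv)
  constructor <;> by_contra! h0
  · nlinarith [mul_nonneg (sub_nonneg.2 h0) (sub_nonneg.2 (h0.trans huv))]
  · nlinarith [mul_nonneg (sub_nonneg.2 h0) (sub_nonneg.2 (huv.trans h0))]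

/-- The point `v` is seen from `p` strictly between `l` and `r`. -/
theorem cross_pos_of_sight {p l r v : ℝ × ℝ} (hl : l.2 < p.2) (hr : r.2 < p.2)
    (hlr : sight p l r ≤ 0) (hle : l.1 ≤ r.1) (hlv : 0 < sight p l v) (hrv : 0 < sight p r v) :
    0 < (l.1 - p.1) * (v.2 - p.2) - (l.2 - p.2) * (v.1 - p.1) ∧
      0 < (v.1 - p.1) * (r.2 - p.2) - (v.2 - p.2) * (r.1 - p.1) := by
  obtain ⟨h1, h2⟩ := lt_and_lt_of_sight_nonpos hl hr hlr hle
  simp only [sight] at *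
  rw [← sub_neg] at hl hr h1
  rw [← sub_pos] at h2
  generalize l.1 - p.1 = l1 at *
  generalize l.2 - p.2 = l2 at *
  generalize r.1 - p.1 = r1 at *
  generalize r.2 - p.2 = r2 at *
  generalize v.1 - p.1 = v1 at *
  generalize v.2 - p.2 = v2 at *
  have hc : 0 < l1 * r2 - l2 * r1 := by
    linarith [mul_pos_of_neg_of_neg h1 hr, mul_neg_of_neg_of_pos hl h2]
  have hL : 0 < l1 ^ 2 + l2 ^ 2 := by
    have := h1.ne
    positivity
  have e1 : (l1 * r2 - l2 * r1) * (l1 * v2 - l2 * v1) =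
      (r1 * v1 + r2 * v2) * (l1 ^ 2 + l2 ^ 2)
        - (l1 * r1 + l2 * r2) * (l1 * v1 + l2 * v2) := by ring
  have h3 : 0 < l1 * v2 - l2 * v1 := by
    refine pos_of_mul_pos_right (a := l1 * r2 - l2 * r1) ?_ hc.le
    rw [e1]
    linarith [mul_pos hrv hL, mul_nonneg (neg_nonneg.2 hlr) hlv.le]
  refine ⟨h3, pos_of_mul_pos_left (b := l1 ^ 2 + l2 ^ 2) ?_ hL.le⟩
  have e2 : (v1 * r2 - v2 * r1) * (l1 ^ 2 + l2 ^ 2) =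
      (l1 * v1 + l2 * v2) * (l1 * r2 - l2 * r1)
        - (l1 * v2 - l2 * v1) * (l1 * r1 + l2 * r2) := by ring
  rw [e2]
  linarith [mul_pos hlv hc, mul_nonneg (neg_nonneg.2 hlr) h3.le]

theorem card_le_card_add_one_of_gaps {W : Type*} [DecidableEq W] (f : W → ℝ) (s : Finset ℝ) :
    ∀ t : Finset W, (∀ x ∈ s, ∀ y ∈ s, x < y → ∃ w ∈ t, x < f w ∧ f w < y) →
      s.card ≤ t.card + 1 := by
  induction s using Finset.induction_on_max with
  | empty => simp
  | insert a s ha ih =>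
    intro t ht
    rw [Finset.card_insert_of_notMem fun h => (ha a h).false]
    rcases s.eq_empty_or_nonempty with rfl | hs
    · simp
    obtain ⟨w, hw, hmw, -⟩ := ht (s.max' hs) (Finset.mem_insert_of_mem (s.max'_mem hs)) a
      (Finset.mem_insert_self _ _) (ha _ (s.max'_mem hs))
    have := ih (t.erase w) fun x hx y hy hxy => by
      obtain ⟨w', hw', h1, h2⟩ := ht x (Finset.mem_insert_of_mem hx) y
        (Finset.mem_insert_of_mem hy) hxy
      refine ⟨w', Finset.mem_erase.2 ⟨?_, hw'⟩, h1, h2⟩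
      rintro rfl
      exact ((h2.trans_le (s.le_max' y hy)).trans hmw).false
    have := Finset.card_erase_add_one hw
    omega

variable {V W : Type*} {κ : V → Bool} {μ : W → Bool} {A : V → ℝ × ℝ} {B : W → ℝ × ℝ}

theorem Drawing.reflect (h : Drawing κ μ A B) :
    Drawing κ μ (fun v => (-(A v).1, (A v).2)) fun w => (-(B w).1, (B w).2) := by
  have hinj : Function.Injective fun z : ℝ × ℝ => (-z.1, z.2) := by
    intro x y hxy
    simpa [Prod.ext_iff] using hxy
  have hs : ∀ p u v : ℝ × ℝ,
      sight (-p.1, p.2) (-u.1, u.2) (-v.1, v.2) = sight p u v := by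
    intro p u v; simp only [sight]; ring
  refine ⟨hinj.comp h.injective_left, hinj.comp h.injective_right,
    fun v w e => h.ne v w (hinj e), fun u v huv => ?_, fun u v huv => ?_⟩
  · simpa only [hs] using h.left u v huv
  · simpa only [hs] using h.right u v huv

theorem Drawing.card_part_le [Fintype V] [Fintype W] [DecidableEq W] (h : Drawing κ μ A B)
    (hy : ∀ v w, (A v).2 < (B w).2) (i : Bool) {t : Finset W}
    (ht : ∀ u v w, κ u = i → sight (B w) (A u) (A v) ≤ 0 → w ∈ t) :
    (Finset.univ.filter fun v => κ v = i).card ≤ t.card + 1 := by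
  have hgap : ∀ u v, κ u = i → κ v = i → u ≠ v → (A u).1 ≤ (A v).1 →
      ∃ w ∈ t, (A u).1 < (B w).1 ∧ (B w).1 < (A v).1 := by
    intro u v hu hv huv hle
    obtain ⟨w, hw⟩ := h.left.exists_witness huv (hu.trans hv.symm)
    exact ⟨w, ht u v w hu hw, lt_and_lt_of_sight_nonpos (hy u w) (hy v w) hw hle⟩
  have hinj : Set.InjOn (fun v => (A v).1) (Finset.univ.filter fun v => κ v = i : Finset V) := by
    intro u hu v hv (huv : (A u).1 = (A v).1)
    by_contra hne
    obtain ⟨w, -, h1, h2⟩ := hgap u v (by simpa using hu) (by simpa using hv) hne huv.le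
    linarith
  rw [← Finset.card_image_of_injOn hinj]
  refine card_le_card_add_one_of_gaps (fun w => (B w).1) _ t fun x hx y hy' hxy => ?_
  obtain ⟨u, hu, rfl⟩ := Finset.mem_image.1 hx
  obtain ⟨v, hv, rfl⟩ := Finset.mem_image.1 hy'
  exact hgap u v (by simpa using hu) (by simpa using hv) (by rintro rfl; exact hxy.false) hxy.le

theorem Drawing.card_le [Fintype V] [Fintype W] (h : Drawing κ μ A B)
    (hκ : Function.Surjective κ) (hμ : Function.Surjective μ) :
    Fintype.card V ≤ Fintype.card W + 2 := by
  obtain ⟨A, B, h, hy⟩ := h.exists_horizontal hκ hμ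
  classical
  let T : Bool → Finset W := fun i =>
    Finset.univ.filter fun w => ∃ u v, κ u = i ∧ sight (B w) (A u) (A v) ≤ 0
  have hT : ∀ i, (Finset.univ.filter fun v => κ v = i).card ≤ (T i).card + 1 := fun i =>
    h.card_part_le hy i fun u v w hu hw => by simpa [T] using ⟨u, hu, v, hw⟩
  have hdisj : Disjoint (T true) (T false) := by
    rw [Finset.disjoint_left]
    intro w hw hw'
    obtain ⟨u, v, hu, huv⟩ := (Finset.mem_filter.1 hw).2
    obtain ⟨x, y, hx, hxy⟩ := (Finset.mem_filter.1 hw').2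
    have hux : κ u ≠ κ x := by simp [hu, hx]
    exact hxy.not_gt (h.sight_pos_of_other huv hux (h.same_of_sight hxy ▸ hux))
  have h1 := Finset.card_filter_add_card_filter_not (s := (Finset.univ : Finset V))
    (fun v => κ v = true)
  have h2 := Finset.card_le_univ (T true ∪ T false)
  rw [Finset.card_union_of_disjoint hdisj] at h2
  simp only [Bool.not_eq_true, Finset.card_univ] at h1
  have := hT true
  have := hT false
  omega

theorem Drawing.fst_lt_fst_inner (h : Drawing κ μ A B) (hy : ∀ v w, (A v).2 < (B w).2)
    {p p' q q' : V} {b c : W} (hpq : κ p ≠ κ q) (hq : sight (B c) (A q) (A q') ≤ 0)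
    (hp : sight (B b) (A p) (A p') ≤ 0) (hqq : (A q).1 ≤ (A q').1) (hpp : (A p).1 ≤ (A p').1) :
    (A p).1 < (A q').1 := by
  by_contra! hle
  have hpq' : κ p ≠ κ q' := h.same_of_sight hq ▸ hpq
  have hp'q' : κ p' ≠ κ q' := h.same_of_sight hp ▸ hpq'
  have h1 := (cross_pos_of_sight (hy _ _) (hy _ _) hq hqq (h.left.pos hpq.symm c)
    (h.left.pos hpq'.symm c)).2
  have h2 := (cross_pos_of_sight (hy _ _) (hy _ _) hp hpp (h.left.pos hpq' b)
    (h.left.pos hp'q' b)).1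
  have h3 := (lt_and_lt_of_sight_nonpos (hy _ _) (hy _ _) hq hqq).2
  have h4 := (lt_and_lt_of_sight_nonpos (hy _ _) (hy _ _) hp hpp).1
  have h5 := hy q' c
  have h6 := hy p b
  generalize A p = P at *
  generalize A q' = Q at *
  generalize B b = b at *
  generalize B c = c at *
  have h7 : P.2 < Q.2 := by
    by_contra! h0
    nlinarith [mul_nonneg (sub_nonneg.2 hle) (sub_nonneg.2 h5.le),
      mul_nonneg (sub_nonneg.2 h0) (sub_nonneg.2 h3.le)]
  nlinarith [mul_nonneg (sub_nonneg.2 hle) (sub_nonneg.2 h6.le),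
    mul_pos (sub_pos.2 h7) (sub_pos.2 h4)]

theorem Drawing.fst_lt_fst_right (h : Drawing κ μ A B) (hy : ∀ v w, (A v).2 < (B w).2)
    {p p' q q' : V} {b c : W} (hpq : κ p ≠ κ q) (hq : sight (B c) (A q) (A q') ≤ 0)
    (hp : sight (B b) (A p) (A p') ≤ 0) (hqq : (A q).1 ≤ (A q').1) (hpp : (A p).1 ≤ (A p').1)
    (hcb : (B c).1 ≤ (B b).1) : (A q').1 < (A p').1 := by
  by_contra! hle
  have hpq' : κ p ≠ κ q' := h.same_of_sight hq ▸ hpq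
  have hp'q' : κ p' ≠ κ q' := h.same_of_sight hp ▸ hpq'
  have hp'q : κ p' ≠ κ q := h.same_of_sight hp ▸ hpq
  have c1 := h.left.pos hpq' c
  have c2 := h.left.pos hp'q b
  obtain ⟨hcl, -⟩ := cross_pos_of_sight (hy _ _) (hy _ _) hq hqq (h.left.pos hpq.symm c)
    (h.left.pos hpq'.symm c)
  obtain ⟨-, hcr⟩ := cross_pos_of_sight (hy _ _) (hy _ _) hq hqq (h.left.pos hp'q.symm c)
    (h.left.pos hp'q'.symm c)
  obtain ⟨hbl, -⟩ := cross_pos_of_sight (hy _ _) (hy _ _) hp hpp (h.left.pos hpq b)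
    (h.left.pos hp'q b)
  obtain ⟨-, hbr⟩ := cross_pos_of_sight (hy _ _) (hy _ _) hp hpp (h.left.pos hpq' b)
    (h.left.pos hp'q' b)
  have h3 := (lt_and_lt_of_sight_nonpos (hy _ _) (hy _ _) hq hqq).2
  have h4 := (lt_and_lt_of_sight_nonpos (hy _ _) (hy _ _) hp hpp).2
  have h5 := hy q' c
  have h6 := hy p' b
  simp only [sight] at hq hp c1 c2
  generalize A p = pL at *
  generalize A p' = pR at *
  generalize A q = qL at *
  generalize A q' = qR at *
  generalize B b = b at *
  generalize B c = c at *
  obtain ⟨e1, he1⟩ : ∃ e1, e1 = qR.1 - pR.1 := ⟨_, rfl⟩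
  obtain ⟨e2, he2⟩ : ∃ e2, e2 = qR.2 - pR.2 := ⟨_, rfl⟩
  have he : 0 ≤ e1 := by linarith
  have hRe : 0 < (qR.1 - c.1) * e2 - (qR.2 - c.2) * e1 := by rw [he1, he2]; linarith
  have heT : 0 < e1 * (pR.2 - b.2) - e2 * (pR.1 - b.1) := by rw [he1, he2]; linarith
  have he2neg : e2 < 0 := by
    by_contra! h0
    linarith [mul_nonneg he (sub_nonneg.2 h6.le), mul_nonneg h0 (sub_nonneg.2 h4.le)]
  have hepos : 0 < e1 := by
    rcases he.eq_or_lt with h0 | h0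
    · rw [← h0] at hRe
      linarith [mul_pos (sub_pos.2 h3) (neg_pos.2 he2neg)]
    · exact h0
  have hbc : b.2 < c.2 := by
    have h7 : 0 < e1 * (c.2 - b.2) - e2 * (c.1 - b.1) := by
      have h8 : e1 * (qR.2 - pR.2) - e2 * (qR.1 - pR.1) = 0 := by rw [he1, he2]; ring
      linarith
    have h9 : 0 < e1 * (c.2 - b.2) := by
      linarith [mul_nonneg (neg_nonneg.2 he2neg.le) (sub_nonneg.2 hcb)]
    exact sub_pos.1 (pos_of_mul_pos_right h9 he)
  have hRT : 0 < (qR.1 - c.1) * (pR.2 - b.2) - (qR.2 - c.2) * (pR.1 - b.1) := by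
    refine pos_of_mul_pos_left (b := e1) ?_ he
    have : ((qR.1 - c.1) * (pR.2 - b.2) - (qR.2 - c.2) * (pR.1 - b.1)) * e1 =
      ((qR.1 - c.1) * e2 - (qR.2 - c.2) * e1) * (pR.1 - b.1)
        + (e1 * (pR.2 - b.2) - e2 * (pR.1 - b.1)) * (qR.1 - c.1) := by ring
    rw [this]
    exact add_pos (mul_pos hRe (sub_pos.2 h4)) (mul_pos heT (sub_pos.2 h3))
  obtain ⟨d1, hd1⟩ : ∃ d1, d1 = pL.1 - qL.1 := ⟨_, rfl⟩
  obtain ⟨d2, hd2⟩ : ∃ d2, d2 = pL.2 - qL.2 := ⟨_, rfl⟩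
  have hdR : 0 < d1 * (qR.1 - c.1) + d2 * (qR.2 - c.2) := by rw [hd1, hd2]; linarith
  have hdT : d1 * (pR.1 - b.1) + d2 * (pR.2 - b.2) < 0 := by rw [hd1, hd2]; linarith
  have hd2neg : d2 < 0 := by
    have h7 : d2 * ((qR.1 - c.1) * (pR.2 - b.2) - (qR.2 - c.2) * (pR.1 - b.1)) < 0 := by
      linarith [mul_pos hdR (sub_pos.2 h4), mul_pos (neg_pos.2 hdT) (sub_pos.2 h3)]
    exact neg_of_mul_neg_left h7 hRT.le
  have hd1neg : d1 < 0 := by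
    refine neg_of_mul_neg_left (b := pR.1 - b.1) ?_ (sub_nonneg.2 h4.le)
    linarith [mul_pos (neg_pos.2 hd2neg) (sub_pos.2 h6)]
  have h7 : 0 < d1 * (c.2 - b.2) - d2 * (c.1 - b.1) := by
    have h8 : d1 * (pL.2 - qL.2) - d2 * (pL.1 - qL.1) = 0 := by rw [hd1, hd2]; ring
    have h9 : 0 < d1 * (qL.2 - b.2) - d2 * (qL.1 - b.1) := by rw [hd1, hd2]; linarith
    have h10 : 0 < (qL.1 - c.1) * d2 - (qL.2 - c.2) * d1 := by rw [hd1, hd2]; linarith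
    linarith
  linarith [mul_pos (neg_pos.2 hd1neg) (sub_pos.2 hbc),
    mul_nonneg (neg_nonneg.2 hd2neg.le) (sub_nonneg.2 hcb)]

/-- Pairs in different parts alternate from left to right, in the order of their witnesses. -/
theorem Drawing.alternating_of_le (h : Drawing κ μ A B) (hy : ∀ v w, (A v).2 < (B w).2)
    {p p' q q' : V} {b c : W} (hpq : κ p ≠ κ q) (hq : sight (B c) (A q) (A q') ≤ 0)
    (hp : sight (B b) (A p) (A p') ≤ 0) (hqq : (A q).1 ≤ (A q').1) (hpp : (A p).1 ≤ (A p').1)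
    (hcb : (B c).1 ≤ (B b).1) :
    (A q).1 < (A p).1 ∧ (A p).1 < (A q').1 ∧ (A q').1 < (A p').1 := by
  refine ⟨?_, h.fst_lt_fst_inner hy hpq hq hp hqq hpp, h.fst_lt_fst_right hy hpq hq hp hqq hpp hcb⟩
  have hs : ∀ p u v : ℝ × ℝ,
      sight (-p.1, p.2) (-u.1, u.2) (-v.1, v.2) = sight p v u := by
    intro p u v; simp only [sight]; ring
  have hp'q' : κ q' ≠ κ p' := h.same_of_sight hp ▸ h.same_of_sight hq ▸ hpq.symm
  simpa using h.reflect.fst_lt_fst_right (p := q') (p' := q) (q := p') (q' := p) (b := c) (c := b)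
    hy hp'q' (by rwa [hs]) (by rwa [hs]) (neg_le_neg hpp) (neg_le_neg hqq) (neg_le_neg hcb)

theorem Drawing.alternating (h : Drawing κ μ A B) (hy : ∀ v w, (A v).2 < (B w).2)
    {p p' q q' : V} (hpq : κ p ≠ κ q) (hp : κ p = κ p') (hq : κ q = κ q') (hp' : p ≠ p')
    (hq' : q ≠ q') (hpp : (A p).1 ≤ (A p').1) (hqq : (A q).1 ≤ (A q').1) :
    ((A q).1 < (A p).1 ∧ (A p).1 < (A q').1 ∧ (A q').1 < (A p').1) ∨
      ((A p).1 < (A q).1 ∧ (A q).1 < (A p').1 ∧ (A p').1 < (A q').1) := by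
  obtain ⟨b, hb⟩ := h.left.exists_witness hp' hp
  obtain ⟨c, hc⟩ := h.left.exists_witness hq' hq
  rcases le_total (B c).1 (B b).1 with hle | hle
  · exact Or.inl (h.alternating_of_le hy hpq hc hb hqq hpp hle)
  · exact Or.inr (h.alternating_of_le hy hpq.symm hb hc hpp hqq hle)

theorem exists_sorted_pair {α : Type*} (f : α → ℝ) {a b : α} (hab : a ≠ b) (P : α → Prop)
    (ha : P a) (hb : P b) : ∃ x y, P x ∧ P y ∧ x ≠ y ∧ f x ≤ f y := by
  rcases le_total (f a) (f b) with h | h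
  · exact ⟨a, b, ha, hb, hab, h⟩
  · exact ⟨b, a, hb, ha, hab.symm, h⟩

/-- If one part has two vertices, the other part has at most two. -/
theorem Drawing.card_part_le_two [Fintype V] [Finite W] (h : Drawing κ μ A B)
    (hκ : Function.Surjective κ) (hμ : Function.Surjective μ) {p p' : V} (hp' : p ≠ p')
    (hp : κ p = κ p') : (Finset.univ.filter fun v => κ v ≠ κ p).card ≤ 2 := by
  obtain ⟨A, B, h, hy⟩ := h.exists_horizontal hκ hμ
  obtain ⟨r, r', hr, hr', hne, hle⟩ := exists_sorted_pair (fun v => (A v).1) hp'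
    (fun v => κ v = κ p) rfl hp.symm
  by_contra! hcard
  obtain ⟨x, hx, y, hy', z, hz, hxy, hxz, hyz⟩ := Finset.two_lt_card.1 hcard
  simp only [Finset.mem_filter, Finset.mem_univ, true_and] at hx hy' hz
  have key : ∀ u v, κ u ≠ κ p → κ v ≠ κ p → u ≠ v → (A u).1 ≤ (A v).1 →
      ((A u).1 < (A r).1 ∧ (A r).1 < (A v).1 ∧ (A v).1 < (A r').1) ∨
      ((A r).1 < (A u).1 ∧ (A u).1 < (A r').1 ∧ (A r').1 < (A v).1) := by
    intro u v hu hv huv hle'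
    refine h.alternating hy (hr ▸ hu.symm) (hr.trans hr'.symm) ?_ hne huv hle hle'
    revert hu hv
    cases κ u <;> cases κ v <;> cases κ p <;> simp
  have key' : ∀ u v, κ u ≠ κ p → κ v ≠ κ p → u ≠ v →
      (((A u).1 < (A r).1 ∧ (A r).1 < (A v).1 ∧ (A v).1 < (A r').1) ∨
      ((A r).1 < (A u).1 ∧ (A u).1 < (A r').1 ∧ (A r').1 < (A v).1)) ∨
      (((A v).1 < (A r).1 ∧ (A r).1 < (A u).1 ∧ (A u).1 < (A r').1) ∨
      ((A r).1 < (A v).1 ∧ (A v).1 < (A r').1 ∧ (A r').1 < (A u).1)) := by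
    intro u v hu hv huv
    rcases le_total (A u).1 (A v).1 with hle' | hle'
    · exact Or.inl (key u v hu hv huv hle')
    · exact Or.inr (key v u hv hu huv.symm hle')
  have k1 := key' x y hx hy' hxy
  have k2 := key' y z hy' hz hyz
  have k3 := key' x z hx hz hxz
  grind

end Horizontal

section Coordinates

/-- The coordinate pair of a point of the plane. -/
def coords (z : Pt) : ℝ × ℝ := (z 0, z 1)

theorem coords_injective : Function.Injective coords := by
  intro x y h
  simp only [coords, Prod.mk.injEq] at h
  ext i
  fin_cases i
  exacts [h.1, h.2]

theorem mem_gabrielDisk {p u v : Pt} :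
    p ∈ gabrielDisk u v ↔ sight (coords p) (coords u) (coords v) ≤ 0 := by
  rw [gabrielDisk, Metric.mem_closedBall, ← pow_le_pow_iff_left₀ dist_nonneg (by positivity)
    two_ne_zero, div_pow, EuclideanSpace.dist_sq_eq, EuclideanSpace.dist_sq_eq]
  simp only [Fin.sum_univ_two, Real.dist_eq, sq_abs, midpoint_eq_smul_add, PiLp.smul_apply,
    PiLp.add_apply, invOf_eq_inv, smul_eq_mul, sight, coords]
  constructor <;> intro h <;> linarith

theorem gabrielDisk_inter_range_eq_empty {W : Type*} {f : W → Pt} {u v : Pt} :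
    gabrielDisk u v ∩ Set.range f = ∅ ↔
      ∀ w, 0 < sight (coords (f w)) (coords u) (coords v) := by
  simp only [Set.eq_empty_iff_forall_notMem, Set.mem_inter_iff, mem_gabrielDisk]
  constructor
  · intro h w
    by_contra! hw
    exact h (f w) ⟨hw, w, rfl⟩
  · rintro h _ ⟨hw, w, rfl⟩
    exact hw.not_gt (h w)

theorem completeBipartiteGraph_adj_iff_isLeft_ne {V W : Type*} {u v : V ⊕ W} :
    (completeBipartiteGraph V W).Adj u v ↔ u.isLeft ≠ v.isLeft := by
  rcases u with u | u <;> rcases v with v | v <;> simp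

theorem isMWGDrawing_iff {V V' W W' : Type*} [Fintype V] [Fintype V'] [Fintype W] [Fintype W']
    {f : V ⊕ V' → Pt} {g : W ⊕ W' → Pt} :
    IsMWGDrawing (completeBipartiteGraph V V') (completeBipartiteGraph W W') f g ↔
      Drawing Sum.isLeft Sum.isLeft (coords ∘ f) (coords ∘ g) := by
  simp only [IsMWGDrawing, completeBipartiteGraph_adj_iff_isLeft_ne,
    gabrielDisk_inter_range_eq_empty]
  have hdisj : Disjoint (Set.range f) (Set.range g) ↔ ∀ v w, coords (f v) ≠ coords (g w) := by
    refine ⟨fun hd v w e => Set.disjoint_left.1 hd ⟨v, rfl⟩ ⟨w, (coords_injective e).symm⟩,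
      fun hne => Set.disjoint_left.2 ?_⟩
    rintro _ ⟨v, rfl⟩ ⟨w, hw⟩
    exact hne v w (congrArg coords hw.symm)
  rw [hdisj, ← coords_injective.of_comp_iff f, ← coords_injective.of_comp_iff g]
  exact ⟨fun ⟨h1, h2, h3, h4, h5⟩ => ⟨h1, h2, h3, h4, h5⟩,
    fun ⟨h1, h2, h3, h4, h5⟩ => ⟨h1, h2, h3, h4, h5⟩⟩

/-- A drawing with integer coordinates yields a drawing in the plane. -/
theorem Drawing.exists_isMWGDrawing {V V' W W' : Type*} [Fintype V] [Fintype V'] [Fintype W]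
    [Fintype W'] {A : V ⊕ V' → ℤ × ℤ} {B : W ⊕ W' → ℤ × ℤ}
    (h : Drawing Sum.isLeft Sum.isLeft A B) :
    ∃ f g, IsMWGDrawing (completeBipartiteGraph V V') (completeBipartiteGraph W W') f g := by
  let c : ℤ × ℤ → Pt := fun z => !₂[(z.1 : ℝ), (z.2 : ℝ)]
  have hc : ∀ z, coords (c z) = ((z.1 : ℝ), (z.2 : ℝ)) := fun z => by simp [coords, c]
  have hinj : Function.Injective (coords ∘ c) := by
    intro x y hxy
    simpa [hc, Prod.ext_iff] using hxy
  have hs : ∀ p u v, 0 < sight (coords (c p)) (coords (c u)) (coords (c v)) ↔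
      0 < sight p u v := by
    intro p u v
    simp only [hc, sight]
    norm_cast
  refine ⟨c ∘ A, c ∘ B, isMWGDrawing_iff.2 ⟨hinj.comp h.injective_left,
    hinj.comp h.injective_right, fun v w e => h.ne v w (hinj e), fun u v huv => ?_,
    fun u v huv => ?_⟩⟩
  · simpa only [Function.comp_apply, hs] using h.left u v huv
  · simpa only [Function.comp_apply, hs] using h.right u v huv

end Coordinates

section Necessity

theorem isLeft_surjective {a b : ℕ} (ha : 1 ≤ a) (hb : 1 ≤ b) :
    Function.Surjective (Sum.isLeft : Fin a ⊕ Fin b → Bool) := by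
  rintro (_ | _)
  · exact ⟨Sum.inr ⟨0, hb⟩, rfl⟩
  · exact ⟨Sum.inl ⟨0, ha⟩, rfl⟩

theorem Drawing.part_sizes {a b : ℕ} {W : Type*} [Finite W] {μ : W → Bool}
    {A : Fin a ⊕ Fin b → ℝ × ℝ} {B : W → ℝ × ℝ} (h : Drawing Sum.isLeft μ A B)
    (hμ : Function.Surjective μ) (ha : 1 ≤ a) (hab : a ≤ b) : a = 1 ∨ (a = 2 ∧ b = 2) := by
  rcases ha.eq_or_lt with rfl | ha'
  · exact Or.inl rfl
  have h2 := h.card_part_le_two (isLeft_surjective ha (ha.trans hab)) hμ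
    (p := Sum.inl ⟨0, ha⟩) (p' := Sum.inl ⟨1, ha'⟩) (by simp) rfl
  have h3 : (Finset.univ.map (Function.Embedding.inr (α := Fin a) (β := Fin b))).card ≤ 2 := by
    refine (Finset.card_le_card fun x hx => ?_).trans h2
    obtain ⟨i, -, rfl⟩ := Finset.mem_map.1 hx
    simp
  rw [Finset.card_map, Finset.card_fin] at h3
  omega

end Necessity

section Sufficiency

theorem witnessed_star {m : ℕ} {W : Type*} {A : Fin 1 ⊕ Fin m → ℤ × ℤ} {B : W → ℤ × ℤ}
    (hc : ∀ i w, 0 < sight (B w) (A (Sum.inl 0)) (A (Sum.inr i)))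
    (hl : ∀ i j, i < j → ∃ w, sight (B w) (A (Sum.inr i)) (A (Sum.inr j)) ≤ 0) :
    Witnessed Sum.isLeft A B := by
  rintro (u | u) (v | v) huv
  · exact absurd (congrArg Sum.inl (Subsingleton.elim u v)) huv
  · obtain rfl := Subsingleton.elim u 0
    simpa using hc v
  · obtain rfl := Subsingleton.elim v 0
    simpa [sight_comm _ (A (Sum.inr u))] using hc u
  · simp only [Sum.isLeft_inr, ne_eq, not_true_eq_false, false_iff, not_forall, not_lt]
    rcases lt_or_gt_of_ne (fun e => huv (congrArg Sum.inr e) : u ≠ v) with h | h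
    · exact hl u v h
    · simpa only [sight_comm _ (A (Sum.inr u))] using hl v u h

theorem exists_drawing_stars {m k : ℕ} (hm : 1 ≤ m) (hmk : m ≤ k) (hkm : k ≤ m + 2) :
    ∃ (A : Fin 1 ⊕ Fin m → ℤ × ℤ) (B : Fin 1 ⊕ Fin k → ℤ × ℤ),
      Drawing Sum.isLeft Sum.isLeft A B := by
  obtain ⟨H, hH⟩ : ∃ H : ℤ, H = 4 * (m + 1) ^ 2 := ⟨_, rfl⟩
  have hH0 : 16 ≤ H := by
    have : (1 : ℤ) ≤ m := by exact_mod_cast hm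
    nlinarith
  let leaf : Fin k → ℤ × ℤ := fun t => if (t : ℕ) ≤ m then (2 * t + 1, 0) else (-H ^ 2, 0)
  have hleaf : ∀ t : Fin k, (∃ x : ℤ, 1 ≤ x ∧ x ≤ 2 * m + 1 ∧ x = 2 * t + 1 ∧ leaf t = (x, 0)) ∨
      (m < t.1 ∧ leaf t = (-H ^ 2, 0)) := by
    intro t
    by_cases ht : (t : ℕ) ≤ m
    · exact Or.inl ⟨2 * t + 1, by omega, by omega, rfl, if_pos ht⟩
    · exact Or.inr ⟨by omega, if_neg ht⟩
  have hleaf_le : ∀ t : Fin k, (t : ℕ) ≤ m → leaf t = (2 * (t : ℤ) + 1, 0) := fun t ht => if_pos ht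
  refine ⟨Sum.elim (fun _ => (0, H)) fun i => (2 * i + 2, 1),
    Sum.elim (fun _ => (0, -H)) leaf, ?_, ?_, ?_, witnessed_star ?_ ?_, witnessed_star ?_ ?_⟩
  · rintro (u | u) (v | v) h
    · exact congrArg Sum.inl (Subsingleton.elim u v)
    · have := congrArg Prod.snd h
      simp at this; omega
    · have := congrArg Prod.snd h
      simp at this; omega
    · have := congrArg Prod.fst h
      simp at this
      exact congrArg Sum.inr (Fin.ext (by omega))
  · rintro (u | u) (v | v) h
    · exact congrArg Sum.inl (Subsingleton.elim u v)
    · have := congrArg Prod.snd h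
      rcases hleaf v with ⟨x, -, -, -, hx⟩ | ⟨-, hx⟩ <;> simp [hx] at this <;> omega
    · have := congrArg Prod.snd h
      rcases hleaf u with ⟨x, -, -, -, hx⟩ | ⟨-, hx⟩ <;> simp [hx] at this <;> omega
    · have := congrArg Prod.fst h
      refine congrArg Sum.inr (Fin.ext ?_)
      rcases hleaf u with ⟨x, hx1, hx2, hx3, hx⟩ | ⟨hx1, hx⟩ <;>
        rcases hleaf v with ⟨y, hy1, hy2, hy3, hy⟩ | ⟨hy1, hy⟩ <;>
        simp [hx, hy] at this
      · omega
      · nlinarith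
      · nlinarith
      · omega
  · rintro (u | u) (v | v) h
    all_goals have := congrArg Prod.snd h
    · simp at this; omega
    · rcases hleaf v with ⟨x, -, -, -, hx⟩ | ⟨-, hx⟩ <;> simp [hx] at this <;> omega
    · simp at this; omega
    · rcases hleaf v with ⟨x, -, -, -, hx⟩ | ⟨-, hx⟩ <;> simp [hx] at this
  · rintro i (w | w)
    · simp only [sight, Sum.elim_inl, Sum.elim_inr]
      nlinarith
    · have hi : (i : ℤ) + 1 ≤ m := by have := i.2; omega
      rcases hleaf w with ⟨x, hx1, hx2, -, hx⟩ | ⟨-, hx⟩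
      · simp only [sight, Sum.elim_inl, Sum.elim_inr, hx]
        nlinarith [sq_nonneg (x - i - 1)]
      · simp only [sight, Sum.elim_inl, Sum.elim_inr, hx]
        have := sq_nonneg H
        have : 0 ≤ H ^ 2 * (2 * i + 2 + H ^ 2) := by positivity
        linarith
  · intro i j hij
    have hj := j.2
    have hij' : (i : ℕ) < j := hij
    refine ⟨Sum.inr ⟨i + 1, by omega⟩, ?_⟩
    have h1 : ((i : ℕ) : ℤ) + 1 ≤ j := by omega
    have hl := hleaf_le ⟨i + 1, by omega⟩ (hij'.trans hj)
    simp only [sight, Sum.elim_inr, hl]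
    push_cast
    nlinarith
  · rintro t (w | w)
    · rcases hleaf t with ⟨x, -, -, -, hx⟩ | ⟨-, hx⟩ <;>
        simp only [sight, Sum.elim_inl, Sum.elim_inr, hx] <;> nlinarith
    · have hw : (w : ℤ) + 1 ≤ m := by have := w.2; omega
      rcases hleaf t with ⟨x, hx1, hx2, -, hx⟩ | ⟨-, hx⟩ <;>
        simp only [sight, Sum.elim_inl, Sum.elim_inr, hx]
      · nlinarith [sq_nonneg (x - 2 * (2 * w + 2))]
      · have := sq_nonneg H
        have : 0 ≤ (2 * (w : ℤ) + 2) * (2 * w + 2 + H ^ 2) := by positivity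
        linarith
  · intro s t hst
    have hst' : (s : ℕ) < t := hst
    have ht := t.2
    have hs := hleaf_le s (by omega)
    rcases hleaf t with ⟨x, hx1, hx2, hx3, hx⟩ | ⟨-, hx⟩
    · refine ⟨Sum.inr ⟨s, by omega⟩, ?_⟩
      simp only [sight, Sum.elim_inr, hs, hx]
      nlinarith
    · refine ⟨Sum.inl 0, ?_⟩
      simp only [sight, Sum.elim_inl, Sum.elim_inr, hs, hx]
      nlinarith [mul_nonneg (sq_nonneg H) (Int.natCast_nonneg (s : ℕ))]

theorem exists_drawing_fourCycle_star {m : ℕ} (hm : 1 ≤ m) (hm' : m ≤ 5) :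
    ∃ (A : Fin 2 ⊕ Fin 2 → ℤ × ℤ) (B : Fin 1 ⊕ Fin m → ℤ × ℤ),
      Drawing Sum.isLeft Sum.isLeft A B := by
  interval_cases m
  · refine ⟨Sum.elim ![(-69, -77), (57, 0)] ![(104, -43), (-40, -50)],
      Sum.elim ![(60, 18)] ![(18, 29)], ?_, ?_, ?_, ?_, ?_⟩ <;>
      first | decide | (unfold Witnessed sight; decide)
  · refine ⟨Sum.elim ![(-6, -8), (4, -1)] ![(-4, -2), (63, -28)],
      Sum.elim ![(-2, 16)] ![(-5, -1), (5, 10)], ?_, ?_, ?_, ?_, ?_⟩ <;>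
      first | decide | (unfold Witnessed sight; decide)
  · refine ⟨Sum.elim ![(45, -12), (-849, -1426)] ![(-38, -95), (1073, -837)],
      Sum.elim ![(517, 2257)] ![(1692, -230), (128, 75), (17, 4)], ?_, ?_, ?_, ?_, ?_⟩ <;>
      first | decide | (unfold Witnessed sight; decide)
  · refine ⟨Sum.elim ![(7, -17), (-172, -103)] ![(-38, -28), (33, -61)],
      Sum.elim ![(79, 144)] ![(79, -46), (-5, 1), (17, -13), (-202, 93)], ?_, ?_, ?_, ?_, ?_⟩ <;>
      first | decide | (unfold Witnessed sight; decide)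
  · refine ⟨Sum.elim ![(76, -36), (-36, -31)] ![(23, 4), (-96, -98)],
      Sum.elim ![(-78, 208)] ![(-332, -66), (34, 18), (-83, -11), (-4, 25), (397, 199)],
      ?_, ?_, ?_, ?_, ?_⟩ <;>
      first | decide | (unfold Witnessed sight; decide)

theorem exists_drawing_fourCycles :
    ∃ (A : Fin 2 ⊕ Fin 2 → ℤ × ℤ) (B : Fin 2 ⊕ Fin 2 → ℤ × ℤ),
      Drawing Sum.isLeft Sum.isLeft A B := by
  refine ⟨Sum.elim ![(-262, 57), (-64, -201)] ![(-48, -137), (-310, 58)],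
    Sum.elim ![(-175, 123), (795, -33)] ![(-27, 787), (-10, -32)], ?_, ?_, ?_, ?_, ?_⟩ <;>
    first | decide | (unfold Witnessed sight; decide)

end Sufficiency

end MutualWitness

/-- Theorem 2: characterization of the MWG-drawable pairs of complete bipartite graphs. -/
theorem stmt14 (a₀ b₀ a₁ b₁ : ℕ) (ha₀ : 1 ≤ a₀) (hab₀ : a₀ ≤ b₀)
    (ha₁ : 1 ≤ a₁) (hab₁ : a₁ ≤ b₁) :
    (∃ (f₀ : Fin a₀ ⊕ Fin b₀ → Pt) (f₁ : Fin a₁ ⊕ Fin b₁ → Pt),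
        IsMWGDrawing (completeBipartiteGraph (Fin a₀) (Fin b₀))
          (completeBipartiteGraph (Fin a₁) (Fin b₁)) f₀ f₁) ↔
      (|((a₀ + b₀ : ℕ) : ℤ) - ((a₁ + b₁ : ℕ) : ℤ)| ≤ 2 ∧
        (a₀ = 1 ∨ (a₀ = 2 ∧ b₀ = 2)) ∧ (a₁ = 1 ∨ (a₁ = 2 ∧ b₁ = 2))) := by
  constructor
  · rintro ⟨f₀, f₁, h⟩
    have h := MutualWitness.isMWGDrawing_iff.1 h
    have s₀ := MutualWitness.isLeft_surjective ha₀ (ha₀.trans hab₀)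
    have s₁ := MutualWitness.isLeft_surjective ha₁ (ha₁.trans hab₁)
    have c₀ := h.card_le s₀ s₁
    have c₁ := h.symm.card_le s₁ s₀
    simp only [Fintype.card_sum, Fintype.card_fin] at c₀ c₁
    refine ⟨?_, h.part_sizes s₁ ha₀ hab₀, h.symm.part_sizes s₀ ha₁ hab₁⟩
    rw [abs_le]
    omega
  · rintro ⟨hn, h₀, h₁⟩
    rw [abs_le] at hn
    suffices ∃ (A : Fin a₀ ⊕ Fin b₀ → ℤ × ℤ) (B : Fin a₁ ⊕ Fin b₁ → ℤ × ℤ),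
        MutualWitness.Drawing Sum.isLeft Sum.isLeft A B by
      obtain ⟨A, B, h⟩ := this
      exact h.exists_isMWGDrawing
    rcases h₀ with rfl | ⟨rfl, rfl⟩ <;> rcases h₁ with rfl | ⟨rfl, rfl⟩
    · rcases le_total b₀ b₁ with hle | hle
      · exact MutualWitness.exists_drawing_stars hab₀ hle (by omega)
      · obtain ⟨B, A, h⟩ := MutualWitness.exists_drawing_stars hab₁ hle (by omega)
        exact ⟨A, B, h.symm⟩
    · obtain ⟨B, A, h⟩ := MutualWitness.exists_drawing_fourCycle_star hab₀ (by omega)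
      exact ⟨A, B, h.symm⟩
    · exact MutualWitness.exists_drawing_fourCycle_star hab₁ (by omega)
    · exact MutualWitness.exists_drawing_fourCycles
end
end

section
/- For i = 0, 1, let G_i be a finite complete multipartite graph given by a surjective map c_i from its vertex set V_i onto a finite index type ι_i with at least two elements, where two distinct vertices are adjacent if and only if they have different c_i-values, and assume every fiber of c_i has at least two elements. Then the pair ⟨G0, G1⟩ admits an MWG-drawing if and only if both graphs are K_{2,2}, i.e. for each i ∈ {0,1}, ι_i has exactly two elements and every fiber of c_i has exactly two elements. -/
noncomputable section

/-- Two finite point sets separated by a vertical line, recorded through the slopes `m a w` of the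
lines joining a point `a` on the right to a point `w` on the left; `xA`, `xB` are the distances to
the separating line and the ordinates `yB` are negated, so that the two sides play symmetric roles.
A pair of points in different parts sees no obtuse angle, a pair inside a part sees one. -/
structure SlopeSystem {A B ι κ : Type*} (m : A → B → ℝ) (xA yA : A → ℝ) (xB yB : B → ℝ)
    (π : A → ι) (ρ : B → κ) : Prop where
  posA : ∀ a, 0 < xA a
  posB : ∀ w, 0 < xB w
  slope : ∀ a w, m a w * (xA a + xB w) = yA a + yB w
  adjA : ∀ a b, π a ≠ π b → ∀ w, -1 < m a w * m b w
  adjB : ∀ w x, ρ w ≠ ρ x → ∀ a, -1 < m a w * m a x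
  witA : ∀ a b, a ≠ b → π a = π b → ∃ w, m a w * m b w ≤ -1
  witB : ∀ w x, w ≠ x → ρ w = ρ x → ∃ a, m a w * m a x ≤ -1
  mateA : ∀ a, ∃ b, b ≠ a ∧ π b = π a
  mateB : ∀ w, ∃ x, x ≠ w ∧ ρ x = ρ w
  otherA : ∀ a, ∃ b, π b ≠ π a
  otherB : ∀ w, ∃ x, ρ x ≠ ρ w

/-- The point `w` sees the points `a` (above) and `b` (below) of the part `P` at a non-acute
angle. -/
def Witness {A B ι : Type*} (m : A → B → ℝ) (π : A → ι) (P : ι) (w : B) (a b : A) : Prop :=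
  π a = P ∧ π b = P ∧ m b w < m a w ∧ m a w * m b w ≤ -1

/-- `r` is closest to the separating line among the points witnessing a pair of `P`. -/
def IsNearestWitness {A B ι : Type*} (m : A → B → ℝ) (xB : B → ℝ) (π : A → ι) (P : ι) (r : B) :
    Prop :=
  (∃ a b, Witness m π P r a b) ∧ ∀ w a b, Witness m π P w a b → xB r ≤ xB w

theorem Witness.pos {A B ι : Type*} {m : A → B → ℝ} {π : A → ι} {P : ι} {w : B} {a b : A}
    (h : Witness m π P w a b) : 0 < m a w := by
  obtain ⟨-, -, h1, h2⟩ := h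
  by_contra! h3
  nlinarith [mul_nonneg_of_nonpos_of_nonpos h3 (h1.le.trans h3)]

theorem Witness.neg {A B ι : Type*} {m : A → B → ℝ} {π : A → ι} {P : ι} {w : B} {a b : A}
    (h : Witness m π P w a b) : m b w < 0 := by
  have h0 := h.pos
  obtain ⟨-, -, h1, h2⟩ := h
  by_contra! h3
  nlinarith [mul_nonneg h0.le h3]

/-- A witness of a pair also witnesses, at another place, any pair seen under a wider angle. -/
theorem Witness.widen {A B ι : Type*} {m : A → B → ℝ} {π : A → ι} {P : ι} {w x : B} {a b c d : A}
    (h : Witness m π P w a b) (hc : π c = P) (hd : π d = P)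
    (h1 : m a w ≤ m c x) (h2 : m d x ≤ m b w) : Witness m π P x c d := by
  have h3 := h.pos
  have h4 := h.neg
  refine ⟨hc, hd, by linarith, ?_⟩
  nlinarith [h.2.2.2, mul_nonneg (sub_nonneg.2 h1) (neg_nonneg.2 (h2.trans h4.le)),
    mul_nonneg h3.le (sub_nonneg.2 h2)]

theorem Witness.mirror {A B ι : Type*} {m : A → B → ℝ} {π : A → ι} {P : ι} {w : B} {a b : A}
    (h : Witness m π P w a b) : Witness (fun a w => -m a w) π P w b a :=
  ⟨h.2.1, h.1, neg_lt_neg h.2.2.1, by linarith [h.2.2.2]⟩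

theorem Witness.of_mul_le {A B ι : Type*} {m : A → B → ℝ} {π : A → ι} {w : B} {a b : A}
    (hab : π a = π b) (h : m a w * m b w ≤ -1) :
    Witness m π (π a) w a b ∨ Witness m π (π a) w b a := by
  rcases lt_trichotomy (m a w) (m b w) with h1 | h1 | h1
  · exact Or.inr ⟨hab.symm, rfl, h1, by rwa [mul_comm]⟩
  · rw [h1] at h
    nlinarith [mul_self_nonneg (m b w)]
  · exact Or.inl ⟨rfl, hab.symm, h1, h⟩

theorem exists_isNearestWitness {A B ι : Type*} [Finite B] {m : A → B → ℝ} {π : A → ι} {P : ι}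
    (xB : B → ℝ) (h : ∃ w a b, Witness m π P w a b) : ∃ r, IsNearestWitness m xB π P r := by
  obtain ⟨r, hr, hmin⟩ := Set.exists_min_image {w | ∃ a b, Witness m π P w a b} xB
    (Set.toFinite _) h
  exact ⟨r, hr, fun w a b hw => hmin w ⟨a, b, hw⟩⟩

namespace SlopeSystem

variable {A B ι κ : Type*} {m : A → B → ℝ} {xA yA : A → ℝ} {xB yB : B → ℝ} {π : A → ι}
  {ρ : B → κ}

/-- Exchange of the two sides. -/
theorem swap (S : SlopeSystem m xA yA xB yB π ρ) :
    SlopeSystem (fun w a => m a w) xB yB xA yA ρ π where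
  posA := S.posB
  posB := S.posA
  slope w a := by linarith [S.slope a w]
  adjA := S.adjB
  adjB := S.adjA
  witA := S.witB
  witB := S.witA
  mateA := S.mateB
  mateB := S.mateA
  otherA := S.otherB
  otherB := S.otherA

/-- Reflection in a horizontal line. -/
theorem mirror (S : SlopeSystem m xA yA xB yB π ρ) :
    SlopeSystem (fun a w => -m a w) xA (fun a => -yA a) xB (fun w => -yB w) π ρ where
  posA := S.posA
  posB := S.posB
  slope a w := by linarith [S.slope a w]
  adjA := by simpa using S.adjA
  adjB := by simpa using S.adjB
  witA := by simpa using S.witA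
  witB := by simpa using S.witB
  mateA := S.mateA
  mateB := S.mateB
  otherA := S.otherA
  otherB := S.otherB

theorem lt_iff_left (S : SlopeSystem m xA yA xB yB π ρ) (a : A) (w x : B) :
    m a w < m a x ↔ m a w * (xB x - xB w) < yB x - yB w := by
  have h1 := S.slope a w
  have h2 := S.slope a x
  have h3 : yB x - yB w - m a w * (xB x - xB w) = (m a x - m a w) * (xA a + xB x) := by
    linear_combination h1 - h2
  rw [← sub_pos, ← sub_pos (b := m a w * (xB x - xB w)), h3,
    mul_pos_iff_of_pos_right (add_pos (S.posA a) (S.posB x))]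

theorem lt_iff_right (S : SlopeSystem m xA yA xB yB π ρ) (a : A) (w x : B) :
    m a w < m a x ↔ m a x * (xB x - xB w) < yB x - yB w := by
  have h1 := S.slope a w
  have h2 := S.slope a x
  have h3 : yB x - yB w - m a x * (xB x - xB w) = (m a x - m a w) * (xA a + xB w) := by
    linear_combination h1 - h2
  rw [← sub_pos, ← sub_pos (b := m a x * (xB x - xB w)), h3,
    mul_pos_iff_of_pos_right (add_pos (S.posA a) (S.posB w))]

/-- If `w` lies above `x` as seen from `a` and `b`, then also as seen from any `e` in the cone with
apex `w` spanned by `a` and `b`. -/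
theorem lt_of_mem_cone_left (S : SlopeSystem m xA yA xB yB π ρ) {a b e : A} {w x : B}
    (h1 : m b w < m e w) (h2 : m e w < m a w) (ha : m a w < m a x) (hb : m b w < m b x) :
    m e w < m e x := by
  rw [S.lt_iff_left] at *
  rcases le_total 0 (xB x - xB w) with h | h
  · exact (mul_le_mul_of_nonneg_right h2.le h).trans_lt ha
  · exact (mul_le_mul_of_nonpos_right h1.le h).trans_lt hb

theorem lt_of_mem_cone_right (S : SlopeSystem m xA yA xB yB π ρ) {a b e : A} {w x : B}
    (h1 : m b x < m e x) (h2 : m e x < m a x) (ha : m a w < m a x) (hb : m b w < m b x) :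
    m e w < m e x := by
  rw [S.lt_iff_right] at *
  rcases le_total 0 (xB x - xB w) with h | h
  · exact (mul_le_mul_of_nonneg_right h2.le h).trans_lt ha
  · exact (mul_le_mul_of_nonpos_right h1.le h).trans_lt hb

/-- If the line through `w` and `x` separates `a` from `e`, then `w` and `x` see `a` and `e` in the
same order. -/
theorem le_of_separated (S : SlopeSystem m xA yA xB yB π ρ) {a e : A} {w x : B}
    (ha : m a x ≤ m a w) (he : m e w ≤ m e x) (hw : m e w < m a w) : m e x ≤ m a x := by
  by_contra! hx
  have a1 := not_lt.1 ((S.lt_iff_left a w x).not.1 ha.not_gt)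
  have a2 := not_lt.1 ((S.lt_iff_right a w x).not.1 ha.not_gt)
  have e1 := not_lt.1 ((S.lt_iff_left e x w).not.1 he.not_gt)
  have e2 := not_lt.1 ((S.lt_iff_right e x w).not.1 he.not_gt)
  have k1 : 0 ≤ xB x - xB w := by
    by_contra! hk
    nlinarith
  have k2 : xB x - xB w ≤ 0 := by
    by_contra! hk
    nlinarith
  have k : xB x - xB w = 0 := le_antisymm k2 k1
  have k' : xB w - xB x = 0 := by linarith
  have a3 := (S.lt_iff_left a x w).not
  have e3 := (S.lt_iff_left e w x).not
  rw [k, mul_zero] at a1 e3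
  rw [k', mul_zero] at e1 a3
  rw [not_lt, not_lt] at a3 e3
  have := a3.2 (by linarith)
  have := e3.2 (by linarith)
  linarith

/-- A point `q` of the triangle `p r s` is nearer to the separating line than `p`, and seen from
points `y` outside the angle `r p s` it lies beyond the line `y p`. -/
theorem lt_of_mem_triangle (S : SlopeSystem m xA yA xB yB π ρ) {p q : A} {r s : B}
    (hr : m q r < m p r) (hs : m p s < m q s) (hp : m p r < m p s) :
    xA q < xA p ∧ (∀ y, m p s ≤ m p y → m p y ≤ m q y) ∧ ∀ y, m p y ≤ m p r → m q y ≤ m p y := by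
  have h1 := (S.swap.lt_iff_right r q p).1 hr
  have h2 := (S.swap.lt_iff_left s p q).1 hs
  have hx : xA q < xA p := by
    by_contra! h
    nlinarith
  refine ⟨hx, fun y hy => ((S.swap.lt_iff_left y p q).2 ?_).le,
    fun y hy => ((S.swap.lt_iff_right y q p).2 ?_).le⟩
  · nlinarith
  · nlinarith

/-- The points outside a part are seen by a witness of a pair of that part inside the angle spanned
by the pair. -/
theorem between (S : SlopeSystem m xA yA xB yB π ρ) {P : ι} {w : B} {a b e : A}
    (h : Witness m π P w a b) (he : π e ≠ P) : m b w < m e w ∧ m e w < m a w := by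
  have h1 := h.pos
  have h2 := h.neg
  obtain ⟨ha, hb, -, h3⟩ := h
  have h4 := S.adjA e a (by rwa [ha]) w
  have h5 := S.adjA e b (by rwa [hb]) w
  constructor
  · by_contra! hc
    nlinarith
  · by_contra! hc
    nlinarith

theorem part_unique (S : SlopeSystem m xA yA xB yB π ρ) {P Q : ι} {w : B} {a b c d : A}
    (h : Witness m π P w a b) (h' : Witness m π Q w c d) : P = Q := by
  by_contra hne
  have h1 := (S.between h (e := c) (by rw [h'.1]; exact Ne.symm hne)).2
  have h2 := (S.between h' (e := a) (by rw [h.1]; exact hne)).2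
  exact lt_asymm h1 h2

/-- Witnesses of pairs in different parts are ordered vertically, consistently for all points of the
other side. -/
theorem comparable (S : SlopeSystem m xA yA xB yB π ρ) {P Q : ι} {w x : B} {a b c d : A}
    (h : Witness m π P w a b) (h' : Witness m π Q x c d) (hne : P ≠ Q) :
    (∀ e, m e w < m e x) ∨ ∀ e, m e x < m e w := by
  have hc : π c ≠ P := by rw [h'.1]; exact hne.symm
  have hd : π d ≠ P := by rw [h'.2.1]; exact hne.symm
  have ha : π a ≠ Q := by rwa [h.1]
  have hb : π b ≠ Q := by rwa [h.2.1]
  have c1 := (S.between h hc).2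
  have d1 := (S.between h hd).1
  have a1 := (S.between h' ha).2
  have b1 := (S.between h' hb).1
  have key : ∀ e, π e ≠ P ∨ π e ≠ Q := fun e => by
    by_contra! hcon
    exact hne (hcon.1.symm.trans hcon.2)
  have up : m a w < m a x ∧ m c w < m c x ∨ m a x < m a w ∧ m c x < m c w := by
    rcases lt_or_ge (m a w) (m a x) with h1 | h1
    · exact Or.inl ⟨h1, by linarith⟩
    · refine Or.inr ⟨?_, ?_⟩
      all_goals
        rcases lt_or_ge (m c x) (m c w) with h2 | h2
        · linarith
        · have := S.le_of_separated h1 h2 c1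
          linarith
  have down : m b w < m b x ∧ m d w < m d x ∨ m b x < m b w ∧ m d x < m d w := by
    rcases lt_or_ge (m b x) (m b w) with h1 | h1
    · exact Or.inr ⟨h1, by linarith⟩
    · refine Or.inl ⟨?_, ?_⟩
      all_goals
        rcases lt_or_ge (m d w) (m d x) with h2 | h2
        · linarith
        · have := S.le_of_separated h1 h2 b1
          linarith
  rcases up with ⟨u1, u2⟩ | ⟨u1, u2⟩ <;> rcases down with ⟨v1, v2⟩ | ⟨v1, v2⟩
  · refine Or.inl fun e => ?_
    rcases key e with he | he
    · exact S.lt_of_mem_cone_left (S.between h he).1 (S.between h he).2 u1 v1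
    · exact S.lt_of_mem_cone_right (S.between h' he).1 (S.between h' he).2 u2 v2
  · exact absurd (S.part_unique (h.widen (x := x) h.1 h.2.1 u1.le v1.le) h') hne
  · exact absurd (S.part_unique h (h'.widen (x := w) h'.1 h'.2.1 u2.le v2.le)) hne
  · refine Or.inr fun e => ?_
    rcases key e with he | he
    · exact S.lt_of_mem_cone_right (S.between h he).1 (S.between h he).2 u1 v1
    · exact S.lt_of_mem_cone_left (S.between h' he).1 (S.between h' he).2 u2 v2

/-- If `w` is above `x` in another part as seen from `u`, then `x` is the lower point of any pair it
forms with a point of its part that is witnessed by `u`. -/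
theorem lt_of_above (S : SlopeSystem m xA yA xB yB π ρ) {u : A} {w x x' : B}
    (h : m u w < m u x) (hne : ρ w ≠ ρ x) (hx : ρ x = ρ x') (hw : m u x * m u x' ≤ -1) :
    Witness (fun w a => m a w) ρ (ρ x) u x x' := by
  rcases Witness.of_mul_le (m := fun w a => m a w) hx hw with h1 | h1
  · exact h1
  · exact absurd (S.swap.between h1 hne).1 h.not_gt

theorem lt_of_below (S : SlopeSystem m xA yA xB yB π ρ) {u : A} {w w' x : B}
    (h : m u w < m u x) (hne : ρ w ≠ ρ x) (hx : ρ w = ρ w') (hw : m u w * m u w' ≤ -1) :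
    Witness (fun w a => m a w) ρ (ρ w) u w' w := by
  rcases Witness.of_mul_le (m := fun w a => m a w) hx hw with h1 | h1
  · exact absurd (S.swap.between h1 hne.symm).2 h.not_gt
  · exact h1

/-- A point of the triangle `p r s` witnesses a pair in every part in which `p` does. -/
theorem witness_of_mem_triangle (S : SlopeSystem m xA yA xB yB π ρ) {p q : A} {r s : B}
    (hr : m q r < m p r) (hs : m p s < m q s) (hp : m p r < m p s) {R : κ} {y z : B}
    (h : Witness (fun w a => m a w) ρ R p y z) :
    ∃ y' z', Witness (fun w a => m a w) ρ R q y' z' := by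
  obtain ⟨-, h1, h2⟩ := S.lt_of_mem_triangle hr hs hp
  obtain ⟨y', hy1, hy2⟩ : ∃ y', m p y ≤ m p y' ∧ m p s ≤ m p y' := by
    rcases le_total (m p y) (m p s) with h3 | h3
    exacts [⟨s, h3, le_rfl⟩, ⟨y, le_rfl, h3⟩]
  obtain ⟨z', hz1, hz2⟩ : ∃ z', m p z' ≤ m p z ∧ m p z' ≤ m p r := by
    rcases le_total (m p z) (m p r) with h3 | h3
    exacts [⟨z, le_rfl, h3⟩, ⟨r, h3, le_rfl⟩]
  have hw : Witness (fun w a => m a w) (fun _ => ()) () p y z := ⟨rfl, rfl, h.2.2⟩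
  have hw' := hw.widen (x := p) (c := y') (d := z') rfl rfl hy1 hz1
  have hyz : ρ y' = ρ z' := by
    by_contra hne
    exact absurd hw'.2.2.2 (S.adjB y' z' hne p).not_ge
  have hw'' : Witness (fun w a => m a w) ρ (ρ y') p y' z' := ⟨rfl, hyz.symm, hw'.2.2⟩
  have hR : ρ y' = R := S.swap.part_unique hw'' h
  exact ⟨y', z', hw''.widen (x := q) rfl hyz.symm (h1 y' hy2) (h2 z' hz2) |> fun t => hR ▸ t⟩

theorem triangle_top (S : SlopeSystem m xA yA xB yB π ρ) {P Q : ι} (hne : P ≠ Q) {r s : B}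
    {p₁ p₂ q₁ q₂ : A} (h : Witness m π P r p₁ p₂) (h' : Witness m π Q s q₁ q₂) :
    m q₁ r < m p₁ r ∧ m p₁ s < m q₁ s :=
  ⟨(S.between h (by rw [h'.1]; exact hne.symm)).2, (S.between h' (by rwa [h.1])).2⟩

theorem triangle_bot (S : SlopeSystem m xA yA xB yB π ρ) {P Q : ι} (hne : P ≠ Q) {r s : B}
    {p₁ p₂ q₁ q₂ : A} (h : Witness m π P r p₁ p₂) (h' : Witness m π Q s q₁ q₂) :
    m p₂ r < m q₂ r ∧ m q₂ s < m p₂ s :=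
  ⟨(S.between h (by rw [h'.2.1]; exact hne.symm)).1, (S.between h' (by rwa [h.2.1])).1⟩

theorem exists_witness (S : SlopeSystem m xA yA xB yB π ρ) (a : A) :
    ∃ w b c, Witness m π (π a) w b c := by
  obtain ⟨b, hb, hab⟩ := S.mateA a
  obtain ⟨w, hw⟩ := S.witA a b hb.symm hab.symm
  rcases Witness.of_mul_le hab.symm hw with h | h
  exacts [⟨w, _, _, h⟩, ⟨w, _, _, h⟩]

/-- No pair of nearest witnesses is witnessed. -/
theorem not_witness_nearest (S : SlopeSystem m xA yA xB yB π ρ) {P Q : ι} {R : κ} {t b : B} {u : A}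
    (ht : IsNearestWitness m xB π P t) (hb : IsNearestWitness m xB π Q b)
    (hu : Witness (fun w a => m a w) ρ R u t b) : False := by
  obtain ⟨x, hx⟩ := S.otherB t
  rw [hu.1] at hx
  obtain ⟨v, y, z, hv⟩ := S.swap.exists_witness x
  rcases S.swap.comparable hu hv hx.symm with h | h
  · obtain ⟨h1, h2⟩ := S.swap.triangle_top hx.symm hu hv
    obtain ⟨⟨c, d, hc⟩, hmin⟩ := ht
    obtain ⟨c', d', hc'⟩ := S.swap.witness_of_mem_triangle h1 h2 (h _) hc
    exact (S.swap.lt_of_mem_triangle h1 h2 (h _)).1.not_ge (hmin _ _ _ hc')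
  · obtain ⟨h1, h2⟩ := S.swap.triangle_bot hx hv hu
    obtain ⟨⟨c, d, hc⟩, hmin⟩ := hb
    obtain ⟨c', d', hc'⟩ := S.swap.witness_of_mem_triangle h1 h2 (h _) hc
    exact (S.swap.lt_of_mem_triangle h1 h2 (h _)).1.not_ge (hmin _ _ _ hc')

theorem nearest_part_ne (S : SlopeSystem m xA yA xB yB π ρ) {P Q : ι} (hne : P ≠ Q) {r s : B}
    (hr : IsNearestWitness m xB π P r) (hs : IsNearestWitness m xB π Q s) : ρ r ≠ ρ s := by
  intro h
  have hrs : r ≠ s := by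
    rintro rfl
    obtain ⟨⟨_, _, h1⟩, -⟩ := hr
    obtain ⟨⟨_, _, h2⟩, -⟩ := hs
    exact hne (S.part_unique h1 h2)
  obtain ⟨u, hu⟩ := S.witB r s hrs h
  rcases Witness.of_mul_le (m := fun w a => m a w) h hu with h1 | h1
  · exact S.not_witness_nearest hr hs h1
  · exact S.not_witness_nearest hs hr h1

/-- There is no chain of three points whose middle one is in a part different from the others. -/
theorem not_chain (S : SlopeSystem m xA yA xB yB π ρ) {r s t : B} (h1 : ∀ e, m e r < m e s)
    (h2 : ∀ e, m e s < m e t) (hrs : ρ r ≠ ρ s) (hst : ρ s ≠ ρ t) : False := by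
  obtain ⟨s', hs', he⟩ := S.mateB s
  obtain ⟨u, hu⟩ := S.witB s s' hs'.symm he.symm
  exact lt_asymm (S.lt_of_above (h1 u) hrs he.symm hu).2.2.1
    (S.lt_of_below (h2 u) hst he.symm hu).2.2.1

theorem exists_nearest (S : SlopeSystem m xA yA xB yB π ρ) [Finite B] (a : A) :
    ∃ r, IsNearestWitness m xB π (π a) r :=
  exists_isNearestWitness xB (S.exists_witness a)

theorem nearest_comparable (S : SlopeSystem m xA yA xB yB π ρ) {P Q : ι} (hne : P ≠ Q)
    {r s : B} (hr : IsNearestWitness m xB π P r) (hs : IsNearestWitness m xB π Q s) :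
    (∀ e, m e r < m e s) ∨ ∀ e, m e s < m e r := by
  obtain ⟨⟨_, _, h1⟩, -⟩ := hr
  obtain ⟨⟨_, _, h2⟩, -⟩ := hs
  exact S.comparable h1 h2 hne

theorem not_three_parts (S : SlopeSystem m xA yA xB yB π ρ) [Finite B] {a b c : A}
    (hab : π a ≠ π b) (hac : π a ≠ π c) (hbc : π b ≠ π c) : False := by
  obtain ⟨r, hr⟩ := S.exists_nearest a
  obtain ⟨s, hs⟩ := S.exists_nearest b
  obtain ⟨t, ht⟩ := S.exists_nearest c
  have n1 := S.nearest_part_ne hab hr hs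
  have n2 := S.nearest_part_ne hac hr ht
  have n3 := S.nearest_part_ne hbc hs ht
  rcases S.nearest_comparable hab hr hs with h1 | h1 <;>
    rcases S.nearest_comparable hac hr ht with h2 | h2 <;>
    rcases S.nearest_comparable hbc hs ht with h3 | h3
  · exact S.not_chain h1 h3 n1 n3
  · exact S.not_chain h2 h3 n2 n3.symm
  · exact S.not_chain h1 h3 n1 n3
  · exact S.not_chain h2 h1 n2.symm n1
  · exact S.not_chain h1 h2 n1.symm n2
  · exact S.not_chain h2 h3 n2 n3.symm
  · exact S.not_chain h3 h2 n3 n2.symm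
  · exact S.not_chain h3 h1 n3.symm n1.symm

section Order

variable (S : SlopeSystem m xA yA xB yB π ρ) {P Q : ι} {r s : B} (hrs : ∀ e, m e r < m e s)
  (hρ : ρ r ≠ ρ s)

include S hrs hρ

theorem above_of_witness {a b c d : A} {x : B} (hr : Witness m π P r a b)
    (hx : Witness m π Q x c d) (hne : P ≠ Q) (e : A) : m e r < m e x := by
  rcases S.comparable hr hx hne with h | h
  · exact h e
  · exfalso
    by_cases hxr : ρ x = ρ r
    · have : x ≠ r := by
        rintro rfl
        exact hne (S.part_unique hr hx)
      obtain ⟨z, hz⟩ := S.witB r x this.symm hxr.symm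
      exact lt_asymm (h z) (S.lt_of_below (hrs z) hρ hxr.symm hz).2.2.1
    · exact S.not_chain h hrs hxr hρ

theorem below_of_witness {a b c d : A} {w : B} (hs : Witness m π Q s a b)
    (hw : Witness m π P w c d) (hne : P ≠ Q) (e : A) : m e w < m e s := by
  have := S.mirror.above_of_witness (P := Q) (Q := P) (r := s) (s := r) (a := b) (b := a) (c := d)
    (d := c) (x := w) (fun e => neg_lt_neg (hrs e)) hρ.symm
    hs.mirror hw.mirror hne.symm e
  simpa using this

theorem eq_low_of_witness {a b c d : A} {w : B} (hs : Witness m π Q s a b)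
    (hw : Witness m π P w c d) (hne : P ≠ Q) (h : ρ w = ρ r) : w = r := by
  by_contra hwr
  obtain ⟨z, hz⟩ := S.witB w r hwr h
  have h1 := S.lt_of_below (S.below_of_witness hrs hρ hs hw hne z) (h ▸ hρ) h hz
  have h2 := S.lt_of_below (hrs z) hρ h.symm (by rwa [mul_comm])
  exact lt_asymm h1.2.2.1 h2.2.2.1

theorem eq_high_of_witness {a b c d : A} {w : B} (hr : Witness m π P r a b)
    (hw : Witness m π Q w c d) (hne : P ≠ Q) (h : ρ w = ρ s) : w = s := by
  by_contra hwr
  obtain ⟨z, hz⟩ := S.witB w s hwr h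
  have h1 := S.lt_of_above (S.above_of_witness hrs hρ hr hw hne z) (h ▸ hρ) h hz
  have h2 := S.lt_of_above (hrs z) hρ h.symm (by rwa [mul_comm])
  exact lt_asymm h1.2.2.1 h2.2.2.1

/-- The lower of the nearest witnesses on the other side lies in the part witnessed by `r`. -/
theorem part_low {a b u v : A} {K : κ} (hr : Witness m π P r a b)
    (hu : IsNearestWitness (fun w a => m a w) xA ρ K u) (huv : ∀ w, m u w < m v w)
    (hπ : π u ≠ π v) : π u = P := by
  by_contra hne
  obtain ⟨u', hu', he⟩ := S.mateA u
  obtain ⟨x, hx⟩ := S.witA u u' hu'.symm he.symm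
  have hx' := S.swap.lt_of_below (huv x) hπ he.symm hx
  have h := S.above_of_witness hrs hρ hr hx' (Ne.symm hne)
  obtain ⟨h1, h2⟩ := S.triangle_bot (Ne.symm hne) hr hx'
  obtain ⟨⟨c, d, hc⟩, hmin⟩ := hu
  obtain ⟨c', d', hc'⟩ := S.witness_of_mem_triangle h1 h2 (h _) hc
  exact (S.lt_of_mem_triangle h1 h2 (h _)).1.not_ge (hmin _ _ _ hc')

end Order

/-- The lower part has at most one point besides `u`. -/
theorem eq_of_ne_low (S : SlopeSystem m xA yA xB yB π ρ) {r s : B} {u v p₁ p₂ q₁ q₂ : A}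
    {r₁ r₂ s₁ s₂ : B}
    (hrs : ∀ e, m e r < m e s) (hρ : ρ r ≠ ρ s) (huv : ∀ w, m u w < m v w) (hπ : π u ≠ π v)
    (hr : Witness m π (π u) r p₁ p₂) (hs : Witness m π (π v) s q₁ q₂)
    (hu : Witness (fun w a => m a w) ρ (ρ r) u r₁ r₂)
    (hv : Witness (fun w a => m a w) ρ (ρ s) v s₁ s₂)
    (hB : ∀ w, ρ w = ρ r ∨ ρ w = ρ s) {a b : A} (ha : π a = π u) (hb : π b = π u) (hau : a ≠ u)
    (hbu : b ≠ u) : a = b := by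
  have hdom : ∀ (w : B) (v' : A), (∃ c d, Witness m π (π u) w c d) → w ≠ r →
      Witness (fun w a => m a w) ρ (ρ s) v' s w →
      m u r < m u w ∧ m v' w < m v' r ∧ m u w < m v' w := by
    rintro w v' ⟨c, d, hw⟩ hwr hv'
    have h := S.swap.above_of_witness huv hπ hu hv' hρ
    obtain ⟨h1, h2⟩ := S.swap.triangle_bot hρ hu hv'
    obtain ⟨c', d', hc'⟩ := S.swap.witness_of_mem_triangle h1 h2 (h _) hw
    have : r₂ = r := S.eq_low_of_witness hrs hρ hs hc' hπ hu.2.1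
    subst this
    exact ⟨h1, h2, h w⟩
  have hex : ∀ (w : B), (∃ c d, Witness m π (π u) w c d) → w ≠ r →
      ∃ v', Witness (fun w a => m a w) ρ (ρ s) v' s w := by
    rintro w ⟨c, d, hw⟩ hwr
    have hwS : ρ w = ρ s := (hB w).resolve_left fun h =>
      hwr (S.eq_low_of_witness hrs hρ hs hw hπ h)
    have hws : s ≠ w := by
      rintro rfl
      exact hπ (S.part_unique hw hs)
    obtain ⟨v', hv'⟩ := S.witB s w hws hwS.symm
    refine ⟨v', ?_⟩
    rcases Witness.of_mul_le (m := fun w a => m a w) hwS.symm hv' with h | h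
    · exact h
    · exact absurd (S.below_of_witness hrs hρ hs hw hπ v') h.2.2.1.not_gt
  have hlow : ∀ (w : B) (c d : A), Witness m π (π u) w c d → w ≠ r → m c w ≤ m c r := by
    intro w c d hw hwr
    have hgood : ∀ v', Witness (fun w a => m a w) ρ (ρ s) v' s w → m v' w ≤ m c w →
        m c w ≤ m c r := by
      intro v' hv' hle
      obtain ⟨h1, h2, h3⟩ := hdom w v' ⟨c, d, hw⟩ hwr hv'
      exact (S.swap.lt_of_mem_triangle h1 h2 h3).2.1 c hle
    obtain ⟨v', hv'⟩ := hex w ⟨c, d, hw⟩ hwr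
    rcases le_or_gt (m v' w) (m c w) with hle | hlt
    · exact hgood v' hv' hle
    · have hvP : π v' = π u := by
        by_contra hne
        exact absurd (S.between hw hne).2 hlt.not_gt
      have hw' : Witness m π (π u) w v' d := hw.widen hvP hw.2.1 hlt.le le_rfl
      obtain ⟨h1, h2⟩ := S.triangle_top hπ hw' hs
      obtain ⟨y, z, hy⟩ := S.witness_of_mem_triangle h1 h2
        (S.below_of_witness hrs hρ hs hw hπ _) hv'
      have hqv : q₁ = v := S.swap.eq_high_of_witness huv hπ hu hy hρ hs.1
      subst hqv
      exact hgood q₁ (hv'.widen hv'.1 hv'.2.1 h2.le h1.le) (S.between hw hπ.symm).2.le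
  have hru : ∀ x, π x = π u → x ≠ u → Witness m π (π u) r x u := by
    intro x hx hxu
    obtain ⟨w, hw⟩ := S.witA u x hxu.symm hx.symm
    have hw' := S.swap.lt_of_below (huv w) hπ hx.symm hw
    by_cases hwr : w = r
    · exact hwr ▸ hw'
    · obtain ⟨v', hv'⟩ := hex w ⟨_, _, hw'⟩ hwr
      exact hw'.widen hx rfl (hlow w x u hw' hwr) (hdom w v' ⟨_, _, hw'⟩ hwr hv').1.le
  have hmain : ∀ (w : B) (c d : A), d ≠ u → ¬ Witness m π (π u) w c d := by
    intro w c d hdu hw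
    have hrd := hru d hw.2.1 hdu
    obtain ⟨h1, h2⟩ := S.triangle_top hπ hrd hs
    have h3 := (S.between hw (e := q₁) (by rw [hs.1]; exact hπ.symm)).1
    have h4 := (S.lt_of_mem_triangle h1 h2 (hrs d)).2.2 w (hw.neg.trans hrd.pos).le
    exact h3.not_ge h4
  by_contra hab
  obtain ⟨w, hw⟩ := S.witA a b hab (ha.trans hb.symm)
  rcases Witness.of_mul_le (ha.trans hb.symm) hw with h | h
  · exact hmain w a b hbu (ha ▸ h)
  · exact hmain w b a hau (ha ▸ h)

theorem exists_eq_of_ne (S : SlopeSystem m xA yA xB yB π ρ) [Finite A] [Finite B] {r s : B}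
    {P Q : ι} (hr : IsNearestWitness m xB π P r) (hs : IsNearestWitness m xB π Q s) (hne : P ≠ Q)
    (hrs : ∀ e, m e r < m e s) :
    (∃ u, ∀ a b, π a = P → π b = P → a ≠ u → b ≠ u → a = b) ∧
      ∃ v, ∀ a b, π a = Q → π b = Q → a ≠ v → b ≠ v → a = b := by
  have hρ := S.nearest_part_ne hne hr hs
  obtain ⟨u, hu⟩ := S.swap.exists_nearest r
  obtain ⟨v, hv⟩ := S.swap.exists_nearest s
  have hπ := S.swap.nearest_part_ne hρ hu hv
  obtain ⟨⟨p₁, p₂, hr'⟩, -⟩ := id hr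
  obtain ⟨⟨q₁, q₂, hs'⟩, -⟩ := id hs
  obtain ⟨⟨r₁, r₂, hu'⟩, -⟩ := id hu
  obtain ⟨⟨s₁, s₂, hv'⟩, -⟩ := id hv
  rcases S.swap.nearest_comparable hρ hu hv with huv | huv
  · have hP : π u = P := S.part_low hrs hρ hr' hu huv hπ
    have hQ : π v = Q := by
      by_contra h
      exact S.not_three_parts (a := u) (b := v) (c := q₁) hπ (by rw [hP, hs'.1]; exact hne)
        (by rwa [hs'.1])
    subst hP hQ
    have hB : ∀ w, ρ w = ρ r ∨ ρ w = ρ s := fun w => by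
      by_contra! h
      exact S.swap.not_three_parts h.1 h.2 hρ
    refine ⟨⟨u, fun a b => S.eq_of_ne_low hrs hρ huv hπ hr' hs' hu' hv' hB⟩,
      ⟨v, fun a b => S.mirror.eq_of_ne_low (r := s) (s := r) (u := v) (v := u)
        (fun e => neg_lt_neg (hrs e)) hρ.symm (fun e => neg_lt_neg (huv e)) hπ.symm
        hs'.mirror hr'.mirror hv'.mirror hu'.mirror fun w => (hB w).symm⟩⟩
  · have hP : π v = P := S.part_low hrs hρ hr' hv huv hπ.symm
    subst hP
    exact absurd (S.swap.part_low huv hπ.symm hv' hr hrs hρ) hρ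

/-- All parts have exactly two points. -/
theorem ncard_part (S : SlopeSystem m xA yA xB yB π ρ) [Finite A] [Finite B] (a : A) :
    Nat.card {b // π b = π a} = 2 := by
  obtain ⟨c, hc⟩ := S.otherA a
  obtain ⟨r, hr⟩ := S.exists_nearest a
  obtain ⟨s, hs⟩ := S.exists_nearest c
  obtain ⟨u, hu⟩ : ∃ u, ∀ x y, π x = π a → π y = π a → x ≠ u → y ≠ u → x = y := by
    rcases S.nearest_comparable hc.symm hr hs with h | h
    · exact (S.exists_eq_of_ne hr hs hc.symm h).1
    · exact (S.exists_eq_of_ne hs hr hc h).2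
  obtain ⟨b, hb, hba⟩ := S.mateA a
  have : {x | π x = π a} = {a, b} := by
    obtain ⟨y, hyu, hy⟩ : ∃ y, y ≠ u ∧ π y = π a := by
      by_cases hau : a = u
      · exact ⟨b, hau ▸ hb, hba⟩
      · exact ⟨a, hau, rfl⟩
    have key : ∀ x, π x = π a → x = u ∨ x = y := fun x hx =>
      or_iff_not_imp_left.2 fun h => hu x y hx hy h hyu
    ext x
    simp only [Set.mem_ofPred_eq, Set.mem_insert_iff, Set.mem_singleton_iff]
    constructor
    · intro hx
      have h1 := key x hx
      have h2 := key a rfl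
      have h3 := key b hba
      grind
    · rintro (rfl | rfl)
      exacts [rfl, hba]
  change Nat.card ↥{x | π x = π a} = 2
  rw [Nat.card_coe_set_eq, this, Set.ncard_pair hb.symm]

/-- There are exactly two parts. -/
theorem card_parts (S : SlopeSystem m xA yA xB yB π ρ) [Finite B] [Fintype ι] [Nonempty ι]
    (hπ : Function.Surjective π) : Fintype.card ι = 2 := by
  obtain ⟨a, -⟩ := hπ (Classical.arbitrary ι)
  obtain ⟨b, hb⟩ := S.otherA a
  rw [← Nat.card_eq_fintype_card, ← Set.ncard_univ, ← Set.ncard_pair hb]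
  congr 1
  ext j
  obtain ⟨c, rfl⟩ := hπ j
  simp only [Set.mem_univ, Set.mem_insert_iff, Set.mem_singleton_iff, true_iff]
  by_contra! h
  exact S.not_three_parts h.1 h.2 hb

end SlopeSystem

/-- The inner product of `a - w` and `b - w`; it is nonpositive if and only if `w` lies in the
Gabriel disk of `a` and `b`. -/
def apexDot (w a b : ℝ × ℝ) : ℝ := (a.1 - w.1) * (b.1 - w.1) + (a.2 - w.2) * (b.2 - w.2)

/-- The closed segments `ab` and `cd` intersect. -/
def Crosses (a b c d : ℝ × ℝ) : Prop :=
  ∃ α β γ δ : ℝ, 0 ≤ α ∧ 0 ≤ β ∧ 0 ≤ γ ∧ 0 ≤ δ ∧ α + β = 1 ∧ γ + δ = 1 ∧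
    α * a.1 + β * b.1 = γ * c.1 + δ * d.1 ∧ α * a.2 + β * b.2 = γ * c.2 + δ * d.2

theorem convex_comb_pos {α β x y : ℝ} (hα : 0 ≤ α) (hβ : 0 ≤ β) (h : α + β = 1) (hx : 0 < x)
    (hy : 0 < y) : 0 < α * x + β * y := by
  rcases hα.eq_or_lt with h1 | h1
  · have : β = 1 := by linarith
    rw [← h1, this]
    linarith
  · positivity

theorem Crosses.swap {a b c d : ℝ × ℝ} (h : Crosses a b c d) : Crosses c d a b := by
  obtain ⟨α, β, γ, δ, h1, h2, h3, h4, h5, h6, h7, h8⟩ := h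
  exact ⟨γ, δ, α, β, h3, h4, h1, h2, h6, h5, h7.symm, h8.symm⟩

theorem Crosses.flip {a b c d : ℝ × ℝ} (h : Crosses a b c d) : Crosses a b d c := by
  obtain ⟨α, β, γ, δ, h1, h2, h3, h4, h5, h6, h7, h8⟩ := h
  exact ⟨α, β, δ, γ, h1, h2, h4, h3, h5, by linarith, by linarith, by linarith⟩

/-- Crossing segments cannot see each other's endpoints under acute angles only. -/
theorem Crosses.exists_apexDot_nonpos {a b c d : ℝ × ℝ} (h : Crosses a b c d) :
    apexDot c a b ≤ 0 ∨ apexDot d a b ≤ 0 ∨ apexDot a c d ≤ 0 ∨ apexDot b c d ≤ 0 := by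
  obtain ⟨α, β, γ, δ, h1, h2, h3, h4, h5, h6, h7, h8⟩ := h
  by_contra! hpos
  obtain ⟨p1, p2, p3, p4⟩ := hpos
  have key : γ * apexDot c a b + δ * apexDot d a b + (α * apexDot a c d + β * apexDot b c d)
      = 0 := by
    obtain rfl : α = 1 - β := by linarith
    obtain rfl : γ = 1 - δ := by linarith
    unfold apexDot
    linear_combination (a.1 + b.1 - c.1 - d.1) * h7 + (a.2 + b.2 - c.2 - d.2) * h8
  have q1 := convex_comb_pos h3 h4 h6 p1 p2
  have q2 := convex_comb_pos h1 h2 h5 p3 p4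
  linarith

theorem exists_cone_coords {w a b e : ℝ × ℝ} (hab : apexDot w a b ≤ 0) (ha : 0 < apexDot w a e)
    (hb : 0 < apexDot w b e) : ∃ l m : ℝ, 0 < l ∧ 0 < m ∧
      e.1 - w.1 = l * (a.1 - w.1) + m * (b.1 - w.1) ∧
      e.2 - w.2 = l * (a.2 - w.2) + m * (b.2 - w.2) := by
  unfold apexDot at *
  generalize a.1 - w.1 = a1 at *
  generalize a.2 - w.2 = a2 at *
  generalize b.1 - w.1 = b1 at *
  generalize b.2 - w.2 = b2 at *
  generalize e.1 - w.1 = e1 at *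
  generalize e.2 - w.2 = e2 at *
  have haa : 0 < a1 ^ 2 + a2 ^ 2 := by
    by_contra! h
    have h1 : a1 = 0 := by nlinarith [sq_nonneg a1, sq_nonneg a2]
    have h2 : a2 = 0 := by nlinarith [sq_nonneg a1, sq_nonneg a2]
    simp [h1, h2] at ha
  have hbb : 0 < b1 ^ 2 + b2 ^ 2 := by
    by_contra! h
    have h1 : b1 = 0 := by nlinarith [sq_nonneg b1, sq_nonneg b2]
    have h2 : b2 = 0 := by nlinarith [sq_nonneg b1, sq_nonneg b2]
    simp [h1, h2] at hb
  have k1 : 0 < (a1 * b2 - a2 * b1) * (e1 * b2 - e2 * b1) := by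
    nlinarith [mul_pos ha hbb, mul_nonneg hb.le (neg_nonneg.2 hab)]
  have k2 : 0 < (a1 * b2 - a2 * b1) * (a1 * e2 - a2 * e1) := by
    nlinarith [mul_pos hb haa, mul_nonneg ha.le (neg_nonneg.2 hab)]
  obtain ⟨D, hDe⟩ : ∃ D, D = a1 * b2 - a2 * b1 := ⟨_, rfl⟩
  rw [← hDe] at k1 k2
  have hD : D ≠ 0 := by
    rintro rfl
    simp at k1
  refine ⟨(e1 * b2 - e2 * b1) / D, (a1 * e2 - a2 * e1) / D, ?_, ?_, ?_, ?_⟩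
  · rw [show (e1 * b2 - e2 * b1) / D = D * (e1 * b2 - e2 * b1) / D ^ 2 by field_simp]
    positivity
  · rw [show (a1 * e2 - a2 * e1) / D = D * (a1 * e2 - a2 * e1) / D ^ 2 by field_simp]
    positivity
  · field_simp
    rw [hDe]
    ring
  · field_simp
    rw [hDe]
    ring

/-- If the segment `ab` meets the segment `cd`, the point `e` lies in the cone with apex `c` spanned
by `a` and `b`, and some linear functional is larger on `a`, `b`, `e` than on `d`, then the segment
`ae` meets `cd` when `e` lies on the other side of the line `cd`. -/
theorem crosses_of_cone {a b c d e n : ℝ × ℝ} {α β γ δ l m : ℝ} (hα : 0 ≤ α) (hβ : 0 ≤ β)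
    (hδ : 0 < δ) (hαβ : α + β = 1) (hγδ : γ + δ = 1)
    (h1 : α * a.1 + β * b.1 = γ * c.1 + δ * d.1) (h2 : α * a.2 + β * b.2 = γ * c.2 + δ * d.2)
    (hγ : 0 ≤ γ) (hm : 0 < m)
    (e1 : e.1 - c.1 = l * (a.1 - c.1) + m * (b.1 - c.1))
    (e2 : e.2 - c.2 = l * (a.2 - c.2) + m * (b.2 - c.2))
    (na : 0 < n.1 * (a.1 - d.1) + n.2 * (a.2 - d.2))
    (nb : 0 < n.1 * (b.1 - d.1) + n.2 * (b.2 - d.2))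
    (ne : 0 < n.1 * (e.1 - d.1) + n.2 * (e.2 - d.2)) (hlm : β * l ≤ α * m) :
    Crosses a e c d := by
  have hM : 0 < α * m - β * l + β := by
    rcases hβ.eq_or_lt with h | h
    · have : α = 1 := by linarith
      rw [← h, this]
      linarith
    · linarith
  obtain rfl : α = 1 - β := by linarith
  obtain rfl : γ = 1 - δ := by linarith
  set M := (1 - β) * m - β * l + β with hMdef
  have ht : β / M ≤ 1 := (div_le_one hM).2 (by linarith)
  have ht0 : 0 ≤ β / M := by positivity
  have hk0 : 0 ≤ δ * m / M := by positivity
  have c1 : (1 - β / M) * a.1 + β / M * e.1 = (1 - δ * m / M) * c.1 + δ * m / M * d.1 := by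
    field_simp
    linear_combination β * e1 + m * h1 + (a.1 - c.1) * hMdef
  have c2 : (1 - β / M) * a.2 + β / M * e.2 = (1 - δ * m / M) * c.2 + δ * m / M * d.2 := by
    field_simp
    linear_combination β * e2 + m * h2 + (a.2 - c.2) * hMdef
  refine ⟨1 - β / M, β / M, 1 - δ * m / M, δ * m / M, by linarith, ht0, ?_, hk0, by ring, by ring,
    c1, c2⟩
  by_contra! hk
  set t := β / M
  set k := δ * m / M
  have s1 : (1 - β) * (n.1 * (a.1 - d.1) + n.2 * (a.2 - d.2)) +
      β * (n.1 * (b.1 - d.1) + n.2 * (b.2 - d.2)) =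
      (1 - δ) * (n.1 * (c.1 - d.1) + n.2 * (c.2 - d.2)) := by
    linear_combination n.1 * h1 + n.2 * h2
  have s2 : (1 - t) * (n.1 * (a.1 - d.1) + n.2 * (a.2 - d.2)) +
      t * (n.1 * (e.1 - d.1) + n.2 * (e.2 - d.2)) =
      (1 - k) * (n.1 * (c.1 - d.1) + n.2 * (c.2 - d.2)) := by
    linear_combination n.1 * c1 + n.2 * c2
  have p1 := convex_comb_pos hα hβ hαβ na nb
  have p2 : 0 < (1 - t) * (n.1 * (a.1 - d.1) + n.2 * (a.2 - d.2)) +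
      t * (n.1 * (e.1 - d.1) + n.2 * (e.2 - d.2)) :=
    convex_comb_pos (by linarith) ht0 (by ring) na ne
  rw [s1] at p1
  rw [s2] at p2
  nlinarith

/-- Two point sets with partitions such that the angle under which a point of one set sees two
points of the other is acute if they are in different parts, and every two points in the same part
are seen by some point at a non-acute angle. -/
structure GabrielSystem {A B ι κ : Type*} (p : A → ℝ × ℝ) (q : B → ℝ × ℝ) (π : A → ι)
    (ρ : B → κ) : Prop where
  ne : ∀ a w, p a ≠ q w
  adjA : ∀ a b, π a ≠ π b → ∀ w, 0 < apexDot (q w) (p a) (p b)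
  adjB : ∀ w x, ρ w ≠ ρ x → ∀ a, 0 < apexDot (p a) (q w) (q x)
  witA : ∀ a b, a ≠ b → π a = π b → ∃ w, apexDot (q w) (p a) (p b) ≤ 0
  witB : ∀ w x, w ≠ x → ρ w = ρ x → ∃ a, apexDot (p a) (q w) (q x) ≤ 0
  mateA : ∀ a, ∃ b, b ≠ a ∧ π b = π a
  mateB : ∀ w, ∃ x, x ≠ w ∧ ρ x = ρ w
  otherA : ∀ a, ∃ b, π b ≠ π a
  otherB : ∀ w, ∃ x, ρ x ≠ ρ w

namespace GabrielSystem

variable {A B ι κ : Type*} {p : A → ℝ × ℝ} {q : B → ℝ × ℝ} {π : A → ι} {ρ : B → κ}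

theorem swap (S : GabrielSystem p q π ρ) : GabrielSystem q p ρ π where
  ne w a := (S.ne a w).symm
  adjA := S.adjB
  adjB := S.adjA
  witA := S.witB
  witB := S.witA
  mateA := S.mateB
  mateB := S.mateA
  otherA := S.otherB
  otherB := S.otherA

theorem part_eq (S : GabrielSystem p q π ρ) {a b c d : A} {w : B} (hab : π a = π b)
    (hcd : π c = π d) (h : apexDot (q w) (p a) (p b) ≤ 0) (h' : apexDot (q w) (p c) (p d) ≤ 0) :
    π a = π c := by
  by_contra hne
  have h1 := S.adjA a c hne w
  have h2 := S.adjA b c (hab ▸ hne) w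
  have h3 := S.adjA a d (hcd ▸ hne) w
  have h4 := S.adjA b d (by rwa [← hab, ← hcd]) w
  obtain ⟨l, m, hl, hm, e1, e2⟩ := exists_cone_coords h h1 h2
  have : apexDot (q w) (p c) (p d) =
      l * apexDot (q w) (p a) (p d) + m * apexDot (q w) (p b) (p d) := by
    unfold apexDot
    rw [e1, e2]
    ring
  nlinarith [mul_pos hl h3, mul_pos hm h4]

/-- No point of one side is in the convex hull of the other side. -/
theorem exists_normal (S : GabrielSystem p q π ρ) [Nonempty A] (w : B) :
    ∃ n : ℝ × ℝ, ∀ e, 0 < n.1 * ((p e).1 - (q w).1) + n.2 * ((p e).2 - (q w).2) := by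
  have hself : ∀ c, 0 < apexDot (q w) (p c) (p c) := by
    intro c
    unfold apexDot
    by_contra! h
    refine S.ne c w (Prod.ext ?_ ?_)
    · nlinarith [mul_self_nonneg ((p c).1 - (q w).1), mul_self_nonneg ((p c).2 - (q w).2)]
    · nlinarith [mul_self_nonneg ((p c).1 - (q w).1), mul_self_nonneg ((p c).2 - (q w).2)]
  obtain ⟨c, hc⟩ : ∃ c, ∀ e, 0 < apexDot (q w) (p c) (p e) := by
    by_cases h : ∃ a b, π a = π b ∧ apexDot (q w) (p a) (p b) ≤ 0
    · obtain ⟨a, b, hab, h⟩ := h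
      obtain ⟨c, hc⟩ := S.otherA a
      refine ⟨c, fun e => ?_⟩
      by_cases he : π c = π e
      · by_contra! h'
        exact hc (S.part_eq hab he h h').symm
      · exact S.adjA c e he w
    · push Not at h
      obtain ⟨c⟩ := ‹Nonempty A›
      refine ⟨c, fun e => ?_⟩
      by_cases he : π c = π e
      · exact h c e he
      · exact S.adjA c e he w
  exact ⟨((p c).1 - (q w).1, (p c).2 - (q w).2), hc⟩

/-- A segment whose endpoints are seen at a non-acute angle from `c` and which meets `cd` can be
replaced by one joining different parts. -/
theorem exists_crosses (S : GabrielSystem p q π ρ) {a b : A} {c d : B} (hab : π a = π b)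
    (hw : apexDot (q c) (p a) (p b) ≤ 0) (h : Crosses (p a) (p b) (q c) (q d)) :
    ∃ a' b', π a' ≠ π b' ∧ Crosses (p a') (p b') (q c) (q d) := by
  have : Nonempty A := ⟨a⟩
  obtain ⟨e, he⟩ := S.otherA a
  obtain ⟨l, m, hl, hm, e1, e2⟩ := exists_cone_coords hw (S.adjA a e he.symm c)
    (S.adjA b e (hab ▸ he.symm) c)
  obtain ⟨n, hn⟩ := S.exists_normal d
  obtain ⟨α, β, γ, δ, h1, h2, h3, h4, h5, h6, h7, h8⟩ := h
  have hδ : 0 < δ := by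
    refine h4.lt_of_ne fun h => ?_
    obtain ⟨n', hn'⟩ := S.exists_normal c
    have ha := hn' a
    have hb := hn' b
    have hγ : γ = 1 := by linarith
    rw [← h, hγ] at h7 h8
    have h9 := convex_comb_pos h1 h2 h5 ha hb
    refine h9.ne' ?_
    linear_combination n'.1 * h7 + n'.2 * h8 - (n'.1 * (q c).1 + n'.2 * (q c).2) * h5
  rcases le_total (β * l) (α * m) with hlm | hlm
  · exact ⟨a, e, he.symm, crosses_of_cone h1 h2 hδ h5 h6 h7 h8 h3 hm e1 e2 (hn a) (hn b) (hn e) hlm⟩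
  · exact ⟨b, e, hab ▸ he.symm, crosses_of_cone h2 h1 hδ (by linarith) h6 (by linarith)
      (by linarith) h3 hl (by linarith) (by linarith) (hn b) (hn a) (hn e) hlm⟩

theorem not_crosses_of_ne_of_ne (S : GabrielSystem p q π ρ) {a b : A} {c d : B} (hab : π a ≠ π b)
    (hcd : ρ c ≠ ρ d) : ¬ Crosses (p a) (p b) (q c) (q d) := by
  intro h
  rcases h.exists_apexDot_nonpos with h1 | h1 | h1 | h1
  · exact h1.not_gt (S.adjA a b hab c)
  · exact h1.not_gt (S.adjA a b hab d)
  · exact h1.not_gt (S.adjB c d hcd a)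
  · exact h1.not_gt (S.adjB c d hcd b)

theorem not_crosses_of_ne (S : GabrielSystem p q π ρ) {a b : A} {c d : B}
    (hcd : ρ c ≠ ρ d) : ¬ Crosses (p a) (p b) (q c) (q d) := by
  intro h
  by_cases hab : π a = π b
  · rcases h.exists_apexDot_nonpos with h1 | h1 | h1 | h1
    · obtain ⟨a', b', h2, h3⟩ := S.exists_crosses hab h1 h
      exact S.not_crosses_of_ne_of_ne h2 hcd h3
    · obtain ⟨a', b', h2, h3⟩ := S.exists_crosses hab h1 h.flip
      exact S.not_crosses_of_ne_of_ne h2 hcd.symm h3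
    · exact h1.not_gt (S.adjB c d hcd a)
    · exact h1.not_gt (S.adjB c d hcd b)
  · exact S.not_crosses_of_ne_of_ne hab hcd h

/-- No segment joining points of one side meets a segment joining points of the other. -/
theorem not_crosses (S : GabrielSystem p q π ρ) {a b : A} {c d : B} :
    ¬ Crosses (p a) (p b) (q c) (q d) := by
  intro h
  by_cases hab : π a = π b
  · by_cases hcd : ρ c = ρ d
    · rcases h.exists_apexDot_nonpos with h1 | h1 | h1 | h1
      · obtain ⟨a', b', h2, h3⟩ := S.exists_crosses hab h1 h
        exact S.swap.not_crosses_of_ne h2 h3.swap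
      · obtain ⟨a', b', h2, h3⟩ := S.exists_crosses hab h1 h.flip
        exact S.swap.not_crosses_of_ne h2 h3.swap
      · obtain ⟨c', d', h2, h3⟩ := S.swap.exists_crosses hcd h1 h.swap
        exact S.not_crosses_of_ne h2 h3.swap
      · obtain ⟨c', d', h2, h3⟩ := S.swap.exists_crosses hcd h1 h.swap.flip
        exact S.not_crosses_of_ne h2 h3.swap
    · exact S.not_crosses_of_ne hcd h
  · exact S.swap.not_crosses_of_ne hab h.swap

end GabrielSystem

namespace GabrielSystem

variable {A B ι κ : Type*} {p : A → ℝ × ℝ} {q : B → ℝ × ℝ} {π : A → ι} {ρ : B → κ}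

/-- The two sides are separated by a line. -/
theorem exists_line (S : GabrielSystem p q π ρ) [Finite A] [Finite B] [Nonempty A] [Nonempty B] :
    ∃ α β γ : ℝ, (∀ a, 0 < α * (p a).1 + β * (p a).2 + γ) ∧
      ∀ w, α * (q w).1 + β * (q w).2 + γ < 0 := by
  set F : A ⊕ B → ℝ × ℝ × ℝ := Sum.elim (fun a => ((p a).1, (p a).2, 1))
    (fun w => (-(q w).1, -(q w).2, -1)) with hF
  by_cases h0 : (0 : ℝ × ℝ × ℝ) ∈ convexHull ℝ (Set.range F)
  · exfalso
    obtain ⟨I, _, z, c, hz, hind, hc, hsum, hcz⟩ := eq_pos_convex_span_of_mem_convexHull h0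
    choose h hh using fun i => hz (Set.mem_range_self i)
    have hcard : Fintype.card I ≤ 4 := by
      have := hind.card_le_finrank_succ
      have h2 := (vectorSpan ℝ (Set.range z)).finrank_le
      simp only [Module.finrank_prod, Module.finrank_self] at h2
      omega
    have hfun : ∀ l : ℝ × ℝ × ℝ, ∑ i, c i *
        (l.1 * (F (h i)).1 + l.2.1 * (F (h i)).2.1 + l.2.2 * (F (h i)).2.2) = 0 := by
      intro l
      have e1 := congrArg (fun t : ℝ × ℝ × ℝ => l.1 * t.1 + l.2.1 * t.2.1 + l.2.2 * t.2.2) hcz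
      simp only [Prod.fst_sum, Prod.snd_sum, Prod.smul_fst, Prod.smul_snd, smul_eq_mul,
        Prod.fst_zero, Prod.snd_zero, mul_zero, add_zero, Finset.mul_sum,
        ← Finset.sum_add_distrib] at e1
      rw [← e1]
      refine Finset.sum_congr rfl fun i _ => ?_
      rw [hh]
      ring
    have hne : Nonempty I := by
      by_contra hI
      rw [not_nonempty_iff] at hI
      simp at hsum
    have hnonneg : ∀ l : ℝ × ℝ × ℝ, (∀ i, 0 ≤
        l.1 * (F (h i)).1 + l.2.1 * (F (h i)).2.1 + l.2.2 * (F (h i)).2.2) → ∀ i,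
        l.1 * (F (h i)).1 + l.2.1 * (F (h i)).2.1 + l.2.2 * (F (h i)).2.2 = 0 := by
      intro l hl i
      have := (Finset.sum_eq_zero_iff_of_nonneg
        (fun i _ => mul_nonneg (hc i).le (hl i))).1 (hfun l) i (Finset.mem_univ i)
      exact (mul_eq_zero.1 this).resolve_left (hc i).ne'
    have hB : ∃ i w, h i = Sum.inr w := by
      by_contra! hcon
      have hA : ∀ i, ∃ a, h i = Sum.inl a := fun i => by
        rcases hi : h i with a | w
        exacts [⟨a, rfl⟩, absurd hi (hcon i w)]
      obtain ⟨i⟩ := hne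
      have := hnonneg (0, 0, 1) (fun i => by obtain ⟨a, ha⟩ := hA i; simp [ha, hF]) i
      obtain ⟨a, ha⟩ := hA i
      simp [ha, hF] at this
    have hA : ∃ i a, h i = Sum.inl a := by
      by_contra! hcon
      have hA : ∀ i, ∃ a, h i = Sum.inr a := fun i => by
        rcases hi : h i with a | w
        exacts [absurd hi (hcon i a), ⟨w, rfl⟩]
      obtain ⟨i⟩ := hne
      have := hnonneg (0, 0, -1) (fun i => by obtain ⟨a, ha⟩ := hA i; simp [ha, hF]) i
      obtain ⟨a, ha⟩ := hA i
      simp [ha, hF] at this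
    obtain ⟨i, a, hi⟩ := hA
    obtain ⟨k, w, hk⟩ := hB
    obtain ⟨j, b, hji, hj⟩ : ∃ j b, j ≠ i ∧ h j = Sum.inl b := by
      by_contra! hcon
      obtain ⟨n, hn⟩ := S.swap.exists_normal a
      have hval : ∀ j x, h j = Sum.inr x → 0 <
          -n.1 * (F (h j)).1 + -n.2 * (F (h j)).2.1 +
            (n.1 * (p a).1 + n.2 * (p a).2) * (F (h j)).2.2 := by
        intro j x hx
        have := hn x
        simp only [hx, hF, Sum.elim_inr]
        linarith
      have := hnonneg (-n.1, -n.2, n.1 * (p a).1 + n.2 * (p a).2) (fun j => by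
        rcases hj : h j with b | x
        · have : j = i := by
            by_contra hne
            exact hcon j b hne hj
          subst this
          obtain rfl : b = a := Sum.inl_injective (hj.symm.trans hi)
          simp only [hF, Sum.elim_inl]
          linarith
        · rw [← hj]
          exact (hval j x hj).le) k
      exact (hval k w hk).ne' this
    obtain ⟨l, x, hlk, hl⟩ : ∃ l x, l ≠ k ∧ h l = Sum.inr x := by
      by_contra! hcon
      obtain ⟨n, hn⟩ := S.exists_normal w
      have hval : ∀ j x, h j = Sum.inl x → 0 <
          n.1 * (F (h j)).1 + n.2 * (F (h j)).2.1 +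
            -(n.1 * (q w).1 + n.2 * (q w).2) * (F (h j)).2.2 := by
        intro j x hx
        have := hn x
        simp only [hx, hF, Sum.elim_inl]
        linarith
      have := hnonneg (n.1, n.2, -(n.1 * (q w).1 + n.2 * (q w).2)) (fun j => by
        rcases hj : h j with b | x
        · rw [← hj]
          exact (hval j b hj).le
        · have : j = k := by
            by_contra hne
            exact hcon j x hne hj
          subst this
          obtain rfl : x = w := Sum.inr_injective (hj.symm.trans hk)
          simp only [hF, Sum.elim_inr]
          linarith) i
      exact (hval i a hi).ne' this
    have hik : i ≠ k := by rintro rfl; simp [hi] at hk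
    have hil : i ≠ l := by rintro rfl; simp [hi] at hl
    have hjk : j ≠ k := by rintro rfl; simp [hj] at hk
    have hjl : j ≠ l := by rintro rfl; simp [hj] at hl
    classical
    have huniv : (Finset.univ : Finset I) = {i, j, k, l} := by
      symm
      apply Finset.eq_univ_of_card
      have : ({i, j, k, l} : Finset I).card = 4 := by
        rw [Finset.card_eq_succ]
        refine ⟨i, {j, k, l}, by simp [hji.symm, hik, hil], rfl, ?_⟩
        rw [Finset.card_eq_three]
        exact ⟨j, k, l, hjk, hjl, hlk.symm, rfl⟩
      have h2 := Finset.card_le_univ ({i, j, k, l} : Finset I)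
      omega
    have hfun' : ∀ t : ℝ × ℝ × ℝ,
        c i * (t.1 * (p a).1 + t.2.1 * (p a).2 + t.2.2) +
        c j * (t.1 * (p b).1 + t.2.1 * (p b).2 + t.2.2) =
        c k * (t.1 * (q w).1 + t.2.1 * (q w).2 + t.2.2) +
        c l * (t.1 * (q x).1 + t.2.1 * (q x).2 + t.2.2) := by
      intro t
      have := hfun t
      rw [huniv, Finset.sum_insert (by simp [hji.symm, hik, hil]),
        Finset.sum_insert (by simp [hjk, hjl]), Finset.sum_pair hlk.symm, hi, hj, hk, hl] at this
      simp only [hF, Sum.elim_inl, Sum.elim_inr] at this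
      linarith
    have f1 := hfun' (1, 0, 0)
    have f2 := hfun' (0, 1, 0)
    have f3 := hfun' (0, 0, 1)
    simp only [one_mul, zero_mul, zero_add, add_zero, mul_one] at f1 f2 f3
    have hci := hc i
    have hcj := hc j
    have hck := hc k
    have hcl := hc l
    refine S.not_crosses (a := a) (b := b) (c := w) (d := x)
      ⟨c i / (c i + c j), c j / (c i + c j), c k / (c i + c j), c l / (c i + c j),
        by positivity, by positivity, by positivity, by positivity, ?_, ?_, ?_, ?_⟩
    · field_simp
    · field_simp
      exact f3.symm
    · field_simp
      linarith
    · field_simp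
      linarith
  · obtain ⟨f, u, hu0, hu⟩ := geometric_hahn_banach_point_closed (convex_convexHull ℝ (Set.range F))
      ((Set.finite_range F).isClosed_convexHull ℝ) h0
    rw [map_zero] at hu0
    have hpos : ∀ i, 0 < f (F i) := fun i =>
      hu0.trans (hu _ (subset_convexHull ℝ _ (Set.mem_range_self i)))
    have hf : ∀ x y z : ℝ, f (x, y, z) = f (1, 0, 0) * x + f (0, 1, 0) * y + f (0, 0, 1) * z := by
      intro x y z
      have : (x, y, z) = x • ((1, 0, 0) : ℝ × ℝ × ℝ) + y • ((0, 1, 0) : ℝ × ℝ × ℝ) +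
          z • ((0, 0, 1) : ℝ × ℝ × ℝ) := by simp
      rw [this, map_add, map_add, map_smul, map_smul, map_smul]
      simp only [smul_eq_mul]
      ring
    refine ⟨f (1, 0, 0), f (0, 1, 0), f (0, 0, 1), fun a => ?_, fun w => ?_⟩
    · have := hpos (Sum.inl a)
      simp only [hF, Sum.elim_inl] at this
      rw [hf] at this
      linarith
    · have := hpos (Sum.inr w)
      simp only [hF, Sum.elim_inr] at this
      rw [hf] at this
      linarith

theorem exists_slopeSystem (S : GabrielSystem p q π ρ) [Finite A] [Finite B] [Nonempty A]
    [Nonempty B] :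
    ∃ m xA yA xB yB, SlopeSystem (A := A) (B := B) m xA yA xB yB π ρ := by
  obtain ⟨α, β, γ, hA, hB⟩ := S.exists_line
  have hαβ : 0 < α ^ 2 + β ^ 2 := by
    by_contra! h
    have h1 : α = 0 := by nlinarith [sq_nonneg α, sq_nonneg β]
    have h2 : β = 0 := by nlinarith [sq_nonneg α, sq_nonneg β]
    obtain ⟨a⟩ := ‹Nonempty A›
    obtain ⟨w⟩ := ‹Nonempty B›
    have := hA a
    have := hB w
    simp only [h1, h2] at *
    linarith
  set xA := fun a => α * (p a).1 + β * (p a).2 + γ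
  set xB := fun w => -(α * (q w).1 + β * (q w).2 + γ)
  set yA := fun a => -β * (p a).1 + α * (p a).2
  set yB := fun w => -(-β * (q w).1 + α * (q w).2)
  have hxB : ∀ w, 0 < xB w := fun w => neg_pos.2 (hB w)
  have hx : ∀ a w, 0 < xA a + xB w := fun a w => add_pos (hA a) (hxB w)
  set m := fun a w => (yA a + yB w) / (xA a + xB w)
  have hm : ∀ a w, m a w * (xA a + xB w) = yA a + yB w := fun a w =>
    div_mul_cancel₀ _ (hx a w).ne'
  have keyA : ∀ a b w, (α ^ 2 + β ^ 2) * apexDot (q w) (p a) (p b) =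
      (xA a + xB w) * (xA b + xB w) * (1 + m a w * m b w) := by
    intro a b w
    have : (xA a + xB w) * (xA b + xB w) * (1 + m a w * m b w) = (xA a + xB w) * (xA b + xB w) +
        (m a w * (xA a + xB w)) * (m b w * (xA b + xB w)) := by ring
    rw [this, hm, hm]
    simp only [apexDot, xA, xB, yA, yB]
    ring
  have keyB : ∀ a w x, (α ^ 2 + β ^ 2) * apexDot (p a) (q w) (q x) =
      (xA a + xB w) * (xA a + xB x) * (1 + m a w * m a x) := by
    intro a w x
    have : (xA a + xB w) * (xA a + xB x) * (1 + m a w * m a x) = (xA a + xB w) * (xA a + xB x) +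
        (m a w * (xA a + xB w)) * (m a x * (xA a + xB x)) := by ring
    rw [this, hm, hm]
    simp only [apexDot, xA, xB, yA, yB]
    ring
  have posA : ∀ a b w, 0 < apexDot (q w) (p a) (p b) ↔ -1 < m a w * m b w := by
    intro a b w
    rw [← mul_pos_iff_of_pos_left hαβ, keyA,
      mul_pos_iff_of_pos_left (mul_pos (hx a w) (hx b w)), neg_lt_iff_pos_add']
  have posB : ∀ a w x, 0 < apexDot (p a) (q w) (q x) ↔ -1 < m a w * m a x := by
    intro a w x
    rw [← mul_pos_iff_of_pos_left hαβ, keyB,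
      mul_pos_iff_of_pos_left (mul_pos (hx a w) (hx a x)), neg_lt_iff_pos_add']
  refine ⟨m, xA, yA, xB, yB, hA, hxB, hm, fun a b hab w => (posA a b w).1 (S.adjA a b hab w),
    fun w x hwx a => (posB a w x).1 (S.adjB w x hwx a), fun a b hne hab => ?_,
    fun w x hne hwx => ?_, S.mateA, S.mateB, S.otherA, S.otherB⟩
  · obtain ⟨w, hw⟩ := S.witA a b hne hab
    exact ⟨w, not_lt.1 ((posA a b w).not.1 hw.not_gt)⟩
  · obtain ⟨a, ha⟩ := S.witB w x hne hwx
    exact ⟨a, not_lt.1 ((posB a w x).not.1 ha.not_gt)⟩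

end GabrielSystem

/-- The coordinates of a point of the plane. -/
def coords (u : Pt) : ℝ × ℝ := (u 0, u 1)

theorem coords_injective : Function.Injective coords := by
  intro u v h
  ext i
  fin_cases i
  · exact congrArg Prod.fst h
  · exact congrArg Prod.snd h

theorem mem_gabrielDisk {u v w : Pt} :
    w ∈ gabrielDisk u v ↔ apexDot (coords w) (coords u) (coords v) ≤ 0 := by
  rw [gabrielDisk, Metric.mem_closedBall, ← sq_le_sq₀ dist_nonneg (by positivity), div_pow,
    EuclideanSpace.dist_sq_eq, EuclideanSpace.dist_sq_eq, midpoint_eq_smul_add]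
  simp only [Fin.sum_univ_two, Real.dist_eq, sq_abs, PiLp.smul_apply, PiLp.add_apply, smul_eq_mul,
    apexDot, coords, invOf_eq_inv]
  constructor <;> intro h <;> linarith

theorem gabrielDisk_inter_range_eq_empty {V : Type*} {u v : Pt} {f : V → Pt} :
    gabrielDisk u v ∩ Set.range f = ∅ ↔
      ∀ w, 0 < apexDot (coords (f w)) (coords u) (coords v) := by
  simp only [Set.eq_empty_iff_forall_notMem, Set.mem_inter_iff, mem_gabrielDisk, not_and',
    Set.forall_mem_range, not_le]

theorem exists_ne_of_two_le_card {V ι : Type*} {c : V → ι} [Finite V]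
    (h : ∀ j, 2 ≤ Nat.card {v // c v = j}) (a : V) : ∃ b, b ≠ a ∧ c b = c a := by
  have : Nontrivial {v // c v = c a} := Finite.one_lt_card_iff_nontrivial.1 (h (c a))
  obtain ⟨⟨b, hb⟩, hne⟩ := exists_ne (⟨a, rfl⟩ : {v // c v = c a})
  exact ⟨b, fun h => hne (Subtype.ext h), hb⟩

theorem exists_ne_of_surjective {V ι : Type*} [Fintype ι] {c : V → ι}
    (hs : Function.Surjective c) (h : 2 ≤ Fintype.card ι) (a : V) : ∃ b, c b ≠ c a := by
  have : Nontrivial ι := Fintype.one_lt_card_iff_nontrivial.1 h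
  obtain ⟨j, hj⟩ := exists_ne (c a)
  obtain ⟨b, rfl⟩ := hs j
  exact ⟨b, hj⟩

theorem exists_equiv_bool {V ι : Type*} [Finite V] [Fintype ι] {c : V → ι}
    (hι : Fintype.card ι = 2) (h : ∀ j, Nat.card {v // c v = j} = 2) :
    ∃ e : V ≃ Bool × Bool, ∀ u v, c u = c v ↔ (e u).1 = (e v).1 := by
  have hι' : Nat.card ι = Nat.card Bool := by simp [hι]
  have h' : ∀ j, Nat.card {v // c v = j} = Nat.card Bool := by simp [h]
  let e₁ : ι ≃ Bool := Classical.choice (Finite.card_eq.1 hι')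
  let e₂ : ∀ j, {v // c v = j} ≃ Bool := fun j => Classical.choice (Finite.card_eq.1 (h' j))
  refine ⟨(Equiv.sigmaFiberEquiv c).symm.trans ((Equiv.sigmaCongrRight e₂).trans
    ((Equiv.sigmaEquivProd ι Bool).trans (e₁.prodCongr (Equiv.refl Bool)))), fun u v => ?_⟩
  exact e₁.injective.eq_iff.symm

/-- The first side of a mutual witness Gabriel drawing of two copies of `K_{2,2}`; the first label
of a point is its part. -/
def drawingLeft : Bool × Bool → ℝ × ℝ
  | (false, false) => (0, -5)
  | (false, true) => (3, 6)
  | (true, false) => (10, 8)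
  | (true, true) => (-1, -2)

/-- The second side of a mutual witness Gabriel drawing of two copies of `K_{2,2}`. -/
def drawingRight : Bool × Bool → ℝ × ℝ
  | (false, false) => (-4, 13)
  | (false, true) => (-3, -1)
  | (true, false) => (-2, 6)
  | (true, true) => (-13, -4)

theorem drawingLeft_spec (u v : Bool × Bool) (h : u ≠ v) :
    u.1 ≠ v.1 ↔ ∀ w, 0 < apexDot (drawingRight w) (drawingLeft u) (drawingLeft v) := by
  rcases u with ⟨_ | _, _ | _⟩ <;> rcases v with ⟨_ | _, _ | _⟩ <;>
    simp [Prod.forall, apexDot, drawingLeft, drawingRight] at h ⊢ <;> norm_num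

theorem drawingRight_spec (u v : Bool × Bool) (h : u ≠ v) :
    u.1 ≠ v.1 ↔ ∀ w, 0 < apexDot (drawingLeft w) (drawingRight u) (drawingRight v) := by
  rcases u with ⟨_ | _, _ | _⟩ <;> rcases v with ⟨_ | _, _ | _⟩ <;>
    simp [Prod.forall, apexDot, drawingLeft, drawingRight] at h ⊢ <;> norm_num

theorem drawingLeft_injective : Function.Injective drawingLeft := by
  rintro ⟨_ | _, _ | _⟩ ⟨_ | _, _ | _⟩ h <;> norm_num [drawingLeft] at h <;> rfl

theorem drawingRight_injective : Function.Injective drawingRight := by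
  rintro ⟨_ | _, _ | _⟩ ⟨_ | _, _ | _⟩ h <;> norm_num [drawingRight] at h <;> rfl

theorem drawingLeft_ne_drawingRight (u v : Bool × Bool) : drawingLeft u ≠ drawingRight v := by
  rcases u with ⟨_ | _, _ | _⟩ <;> rcases v with ⟨_ | _, _ | _⟩ <;>
    norm_num [drawingLeft, drawingRight]

/-- The point of the plane with given coordinates. -/
def ofCoords (x : ℝ × ℝ) : Pt := !₂[x.1, x.2]

theorem coords_ofCoords (x : ℝ × ℝ) : coords (ofCoords x) = x := by
  simp [coords, ofCoords]

theorem ofCoords_injective : Function.Injective ofCoords :=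
  Function.LeftInverse.injective coords_ofCoords

theorem gabrielSystem_of_drawing {V₀ V₁ ι₀ ι₁ : Type*} [Fintype V₀] [Fintype V₁] [Fintype ι₀]
    [Fintype ι₁] {c₀ : V₀ → ι₀} {c₁ : V₁ → ι₁}
    (hs₀ : Function.Surjective c₀) (hs₁ : Function.Surjective c₁)
    (hι₀ : 2 ≤ Fintype.card ι₀) (hι₁ : 2 ≤ Fintype.card ι₁)
    (hfib₀ : ∀ j : ι₀, 2 ≤ Nat.card {v : V₀ // c₀ v = j})
    (hfib₁ : ∀ j : ι₁, 2 ≤ Nat.card {v : V₁ // c₁ v = j})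
    {G₀ : SimpleGraph V₀} {G₁ : SimpleGraph V₁}
    (hG₀ : ∀ u v : V₀, G₀.Adj u v ↔ c₀ u ≠ c₀ v)
    (hG₁ : ∀ u v : V₁, G₁.Adj u v ↔ c₁ u ≠ c₁ v) {f₀ : V₀ → Pt} {f₁ : V₁ → Pt}
    (hf : IsMWGDrawing G₀ G₁ f₀ f₁) :
    GabrielSystem (fun v => coords (f₀ v)) (fun v => coords (f₁ v)) c₀ c₁ := by
  obtain ⟨-, -, hd, h₀, h₁⟩ := hf
  simp only [hG₀, gabrielDisk_inter_range_eq_empty] at h₀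
  simp only [hG₁, gabrielDisk_inter_range_eq_empty] at h₁
  refine ⟨fun a w h => ?_, fun a b h => ?_, fun a b h => ?_, fun a b h hab => ?_,
    fun a b h hab => ?_, exists_ne_of_two_le_card hfib₀, exists_ne_of_two_le_card hfib₁,
    exists_ne_of_surjective hs₀ hι₀, exists_ne_of_surjective hs₁ hι₁⟩
  · exact Set.disjoint_left.1 hd (Set.mem_range_self a) ⟨w, (coords_injective h).symm⟩
  · exact (h₀ a b (ne_of_apply_ne c₀ h)).1 h
  · exact (h₁ a b (ne_of_apply_ne c₁ h)).1 h
  · by_contra! hcon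
    exact (h₀ a b h).2 hcon hab
  · by_contra! hcon
    exact (h₁ a b h).2 hcon hab

/-- Theorem 4: a pair of complete multipartite graphs, all of whose partition sets have
size at least two, is MWG-drawable iff both graphs are `K_{2,2}`. -/
theorem stmt15 {V₀ V₁ ι₀ ι₁ : Type*} [Fintype V₀] [Fintype V₁] [Fintype ι₀] [Fintype ι₁]
    (c₀ : V₀ → ι₀) (c₁ : V₁ → ι₁)
    (hs₀ : Function.Surjective c₀) (hs₁ : Function.Surjective c₁)
    (hι₀ : 2 ≤ Fintype.card ι₀) (hι₁ : 2 ≤ Fintype.card ι₁)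
    (hfib₀ : ∀ j : ι₀, 2 ≤ Nat.card {v : V₀ // c₀ v = j})
    (hfib₁ : ∀ j : ι₁, 2 ≤ Nat.card {v : V₁ // c₁ v = j})
    (G₀ : SimpleGraph V₀) (G₁ : SimpleGraph V₁)
    (hG₀ : ∀ u v : V₀, G₀.Adj u v ↔ c₀ u ≠ c₀ v)
    (hG₁ : ∀ u v : V₁, G₁.Adj u v ↔ c₁ u ≠ c₁ v) :
    (∃ (f₀ : V₀ → Pt) (f₁ : V₁ → Pt), IsMWGDrawing G₀ G₁ f₀ f₁) ↔
      (Fintype.card ι₀ = 2 ∧ Fintype.card ι₁ = 2 ∧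
        (∀ j : ι₀, Nat.card {v : V₀ // c₀ v = j} = 2) ∧
        (∀ j : ι₁, Nat.card {v : V₁ // c₁ v = j} = 2)) := by
  constructor
  · rintro ⟨f₀, f₁, hf⟩
    have : Nonempty ι₀ := Fintype.card_pos_iff.1 (by omega)
    have : Nonempty ι₁ := Fintype.card_pos_iff.1 (by omega)
    have : Nonempty V₀ := (hs₀ (Classical.arbitrary ι₀)).nonempty
    have : Nonempty V₁ := (hs₁ (Classical.arbitrary ι₁)).nonempty
    obtain ⟨m, xA, yA, xB, yB, S⟩ := (gabrielSystem_of_drawing hs₀ hs₁ hι₀ hι₁ hfib₀ hfib₁ hG₀ hG₁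
      hf).exists_slopeSystem
    refine ⟨S.card_parts hs₀, S.swap.card_parts hs₁, fun j => ?_, fun j => ?_⟩
    · obtain ⟨a, rfl⟩ := hs₀ j
      exact S.ncard_part a
    · obtain ⟨a, rfl⟩ := hs₁ j
      exact S.swap.ncard_part a
  · rintro ⟨h₀, h₁, hf₀, hf₁⟩
    obtain ⟨e₀, he₀⟩ := exists_equiv_bool h₀ hf₀
    obtain ⟨e₁, he₁⟩ := exists_equiv_bool h₁ hf₁
    refine ⟨fun v => ofCoords (drawingLeft (e₀ v)), fun v => ofCoords (drawingRight (e₁ v)),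
      ofCoords_injective.comp (drawingLeft_injective.comp e₀.injective),
      ofCoords_injective.comp (drawingRight_injective.comp e₁.injective), ?_, fun u v huv => ?_,
      fun u v huv => ?_⟩
    · rw [Set.disjoint_left]
      rintro _ ⟨u, rfl⟩ ⟨v, h⟩
      exact drawingLeft_ne_drawingRight _ _ (ofCoords_injective h).symm
    · simp only [gabrielDisk_inter_range_eq_empty, coords_ofCoords, hG₀, ne_eq, he₀]
      rw [← ne_eq, drawingLeft_spec _ _ (e₀.injective.ne huv), e₁.forall_congr_left]
      simp
    · simp only [gabrielDisk_inter_range_eq_empty, coords_ofCoords, hG₁, ne_eq, he₁]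
      rw [← ne_eq, drawingRight_spec _ _ (e₁.injective.ne huv), e₀.forall_congr_left]
      simp
end
end

section
/- Let k ≥ 2 and let f be a WG-drawing with witness set P ⊆ ℝ² of a finite complete k-partite graph G all of whose partition classes have exactly two vertices. Assume every point of the image of f has strictly positive y-coordinate and every point of P has strictly negative y-coordinate. Then the convex hull of the image of f is a convex terrain with respect to the x-axis: for every vertex v of G and every real t with 0 ≤ t < y(f(v)), the point with x-coordinate x(f(v)) and y-coordinate t does not belong to the convex hull of the image of f. -/
noncomputable section

/-- A point lies in the Gabriel disk of `u` and `v` iff it sees `u` and `v` under a non-acute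
angle. -/
theorem mem_gabrielDisk_iff (u v p : Pt) :
    p ∈ gabrielDisk u v ↔ (u 0 - p 0) * (v 0 - p 0) + (u 1 - p 1) * (v 1 - p 1) ≤ 0 := by
  have hm (i : Fin 2) : midpoint ℝ u v i = (u i + v i) / 2 := by
    simp [midpoint_eq_smul_add]
    ring
  have h1 : dist p (midpoint ℝ u v) ^ 2
      = (p 0 - (u 0 + v 0) / 2) ^ 2 + (p 1 - (u 1 + v 1) / 2) ^ 2 := by
    rw [EuclideanSpace.dist_sq_eq, Fin.sum_univ_two, Real.dist_eq, Real.dist_eq, sq_abs, sq_abs,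
      hm, hm]
  have h2 : dist u v ^ 2 = (u 0 - v 0) ^ 2 + (u 1 - v 1) ^ 2 := by
    rw [EuclideanSpace.dist_sq_eq, Fin.sum_univ_two, Real.dist_eq, Real.dist_eq, sq_abs, sq_abs]
  rw [gabrielDisk, Metric.mem_closedBall, ← sq_le_sq₀ dist_nonneg (by positivity), div_pow, h1, h2]
  constructor <;> intro h <;> linarith

/-- In the upper half-plane, a vector `(x, y)` making an acute angle with `(c, d)`, where `(c, d)`
makes a non-acute angle with `(a, b)`, lies on the same side of the line spanned by `(a, b)` as
the vertical direction. -/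
theorem mul_cross_nonneg_of_acute {a b c d x y : ℝ} (hd : 0 < d) (hb : 0 < b) (hy : 0 < y)
    (hobt : a * c + b * d ≤ 0) (hac : 0 < c * x + d * y) : 0 ≤ a * (a * y - b * x) := by
  rcases le_total (a * x) 0 with h | h
  · nlinarith [mul_nonneg (sq_nonneg a) hy.le, mul_nonneg hb.le (neg_nonneg.2 h)]
  · have h1 : 0 ≤ d * (a * (a * y - b * x)) := by
      nlinarith [mul_nonneg (sq_nonneg a) hac.le, mul_nonneg h (neg_nonneg.2 hobt)]
    exact nonneg_of_mul_nonneg_right h1 hd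

/-- Lemma 10: the convex hull of a linearly separated WG-drawing of a complete
`k`-partite graph with all classes of size two is a convex terrain w.r.t. the x-axis. -/
theorem stmt16 {V : Type*} [Fintype V] (k : ℕ) (hk : 2 ≤ k)
    (G : SimpleGraph V) (c : V → Fin k)
    (hfib : ∀ j : Fin k, Nat.card {v : V // c v = j} = 2)
    (hG : ∀ u v : V, G.Adj u v ↔ c u ≠ c v)
    (f : V → Pt) (P : Set Pt) (hWG : IsWGDrawing G f P)
    (hy : ∀ v, 0 < f v 1) (hP : ∀ p ∈ P, p 1 < 0) :
    ∀ (v : V) (t : ℝ), 0 ≤ t → t < f v 1 →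
      ∀ q : Pt, q 0 = f v 0 → q 1 = t → q ∉ convexHull ℝ (Set.range f) := by
  intro v t ht htv q hq0 hq1 hq
  obtain ⟨-, -, hadj⟩ := hWG
  obtain ⟨w, hwv, hcw⟩ : ∃ w, w ≠ v ∧ c w = c v := by
    have hfin : Nontrivial {w : V // c w = c v} :=
      (Finite.one_lt_card_iff_nontrivial).1 (by rw [hfib]; norm_num)
    obtain ⟨w, hw⟩ := exists_ne (⟨v, rfl⟩ : {w : V // c w = c v})
    exact ⟨w, fun h => hw (Subtype.ext h), w.2⟩
  obtain ⟨p, hpD, hpP⟩ : (gabrielDisk (f v) (f w) ∩ P).Nonempty := by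
    rw [Set.nonempty_iff_ne_empty]
    exact fun h => (hG v w).1 ((hadj v w hwv.symm).2 h) hcw.symm
  rw [mem_gabrielDisk_iff] at hpD
  have hpos (u : V) : 0 < f u 1 - p 1 := by linarith [hy u, hP p hpP]
  have hne : f v 0 - p 0 ≠ 0 := by
    intro h
    rw [h] at hpD
    nlinarith [mul_pos (hpos v) (hpos w)]
  let φ : Pt → ℝ := fun z => (f v 0 - p 0) *
    ((f v 0 - p 0) * (z 1 - p 1) - (f v 1 - p 1) * (z 0 - p 0))
  have hconv : Convex ℝ {z : Pt | 0 ≤ φ z} := by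
    intro x hx y hy a b ha hb hab
    have h : φ (a • x + b • y) = a * φ x + b * φ y := by
      obtain rfl : b = 1 - a := by linarith
      simp only [φ, PiLp.add_apply, PiLp.smul_apply, smul_eq_mul]
      ring
    simp only [Set.mem_ofPred_eq] at hx hy ⊢
    rw [h]
    positivity
  have hsub : Set.range f ⊆ {z : Pt | 0 ≤ φ z} := by
    rintro _ ⟨u, rfl⟩
    by_cases huw : u = w
    · subst huw
      exact mul_cross_nonneg_of_acute (hpos u) (hpos v) (hpos u) hpD
        (by nlinarith [sq_nonneg (f u 0 - p 0), hpos u])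
    · by_cases hcu : c u = c v
      · have huv : u = v := by
          by_contra huv
          obtain ⟨a, b, -, hab⟩ := Nat.card_eq_two_iff.1 (hfib (c v))
          have hmem (x : {x : V // c x = c v}) : x = a ∨ x = b := by
            have : x ∈ ({a, b} : Set _) := hab ▸ Set.mem_univ x
            simpa using this
          have h1 := hmem ⟨u, hcu⟩
          have h2 := hmem ⟨v, rfl⟩
          have h3 := hmem ⟨w, hcw⟩
          grind
        subst huv
        simp only [Set.mem_ofPred_eq, φ]
        exact le_of_eq (by ring)
      · refine mul_cross_nonneg_of_acute (hpos w) (hpos v) (hpos u) hpD ?_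
        by_contra! h
        have hmem : p ∈ gabrielDisk (f w) (f u) ∩ P := ⟨(mem_gabrielDisk_iff _ _ _).2 h, hpP⟩
        rw [(hadj w u (Ne.symm huw)).1 ((hG w u).2 fun e => hcu (e.symm.trans hcw))] at hmem
        exact hmem
  have hφq : 0 ≤ φ q := convexHull_min hsub hconv hq
  have hsq : 0 < (f v 0 - p 0) ^ 2 := by positivity
  simp only [φ, hq0, hq1] at hφq
  nlinarith [mul_pos hsq (sub_pos.2 htv)]
end
end

section
/- Let k ≥ 2 and let f : Fin(2k) → ℝ² be a WG-drawing with witness set P ⊆ ℝ² of a complete k-partite graph on vertex set Fin(2k) given by a class map c : Fin(2k) → Fin k, with every fiber of c of cardinality exactly 2 and adjacency of distinct vertices given by having different c-values. Assume the x-coordinates x(f(0)) < x(f(1)) < … < x(f(2k−1)) are strictly increasing in the index, every point of the image of f has strictly positive y-coordinate, every point of P has strictly negative y-coordinate, and c(i') = c(i' + k) for every index i' < k (so the partition classes are the pairs {i', i'+k}). Let i < j < k, let p_i ∈ P be a witness for the class {i, i+k} (p_i ∈ D[f(i), f(i+k)]) and let p_j ∈ P be a witness for the class {j, j+k} (p_j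 ∈ D[f(j), f(j+k)]). Then p_i lies in the open left wedge of p_j with respect to f(j) and f(j+k): there exist real numbers s > 0 and t > 0 such that p_i = p_j + s·(f(j) − p_j) − t·(f(j+k) − p_j). -/
noncomputable section

/-- Twice the signed area of the triangle `u v w`; positive when it is counterclockwise. -/
def signedArea (u v w : Pt) : ℝ :=
  (v 0 - u 0) * (w 1 - u 1) - (v 1 - u 1) * (w 0 - u 0)

/-- Coordinate form of the following fact: a vector of the upper half plane that forms acute
angles with `u` and `w` is directed strictly between them if `u` and `w` form no acute angle. -/
theorem cross_pos_of_acute {u₀ u₁ v₀ v₁ w₀ w₁ : ℝ} (hu₁ : 0 < u₁) (hv₁ : 0 < v₁)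
    (hu₀ : u₀ < 0) (hw₀ : 0 < w₀) (huw : u₀ * w₀ + u₁ * w₁ ≤ 0)
    (huv : 0 < u₀ * v₀ + u₁ * v₁) (hw₁ : 0 < w₁) : 0 < w₀ * v₁ - w₁ * v₀ := by
  rcases le_or_gt v₀ 0 with hv₀ | hv₀
  · nlinarith [mul_pos hw₀ hv₁]
  · refine pos_of_mul_pos_right (a := u₁) ?_ hu₁.le
    nlinarith [mul_pos hw₀ huv, mul_nonneg hv₀.le (neg_nonneg.2 huw)]

/-- If the angle `u p w` is not acute and `u`, `w` lie above `p`, then `p` is horizontally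
between `u` and `w`. -/
theorem lt_and_lt_of_not_acute {u w p : Pt} (hu : p 1 < u 1) (hw : p 1 < w 1)
    (huw : u 0 < w 0)
    (h : (u 0 - p 0) * (w 0 - p 0) + (u 1 - p 1) * (w 1 - p 1) ≤ 0) :
    u 0 < p 0 ∧ p 0 < w 0 := by
  have := mul_pos (sub_pos.2 hu) (sub_pos.2 hw)
  constructor <;> by_contra! <;> nlinarith

/-- Seen from `p` below, a point `v` forming acute angles with both `u` and `w`, where the angle
`u p w` is not acute, has direction strictly between those of `u` and `w`. -/
theorem signedArea_pos_of_acute {u v w p : Pt} (hu : p 1 < u 1) (hv : p 1 < v 1)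
    (hw : p 1 < w 1) (huw : u 0 < w 0) (hD : p ∈ gabrielDisk u w)
    (huv : p ∉ gabrielDisk u v) (hvw : p ∉ gabrielDisk v w) :
    0 < signedArea p w v ∧ 0 < signedArea p v u := by
  rw [mem_gabrielDisk_iff] at hD huv hvw
  rw [not_le] at huv hvw
  obtain ⟨hup, hpw⟩ := lt_and_lt_of_not_acute hu hw huw hD
  have h₁ := cross_pos_of_acute (sub_pos.2 hu) (sub_pos.2 hv) (sub_neg.2 hup) (sub_pos.2 hpw)
    hD huv (sub_pos.2 hw)
  have h₂ := cross_pos_of_acute (u₀ := -(w 0 - p 0)) (v₀ := -(v 0 - p 0)) (w₀ := -(u 0 - p 0))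
    (sub_pos.2 hw) (sub_pos.2 hv) (by linarith) (by linarith) (by linarith) (by linarith)
    (sub_pos.2 hu)
  unfold signedArea
  constructor <;> linarith

/-- If `q` and `p` see `a` on opposite sides of `b`, and `a` lies to the left of `b`, `p` and `q`,
then `p` lies to the left of the line from `q` to `b`: otherwise `a` would be in the
triangle `b q p`. -/
theorem signedArea_pos_of_lt {a b p q : Pt} (ha : 0 < a 1) (hb : 0 < b 1) (hp : p 1 < 0)
    (hq : q 1 < 0) (hab : a 0 < b 0) (hap : a 0 < p 0) (haq : a 0 < q 0)
    (hqab : 0 < signedArea q a b) (hpba : 0 < signedArea p b a) : 0 < signedArea q b p := by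
  by_contra! hT
  have hsum : signedArea q a b + signedArea p b a + signedArea q p a = -signedArea q b p := by
    unfold signedArea; ring
  have hx : signedArea q a b * (p 0 - a 0) + signedArea p b a * (q 0 - a 0) +
      signedArea q p a * (b 0 - a 0) = 0 := by
    unfold signedArea; ring
  have hy : signedArea q a b * p 1 + signedArea p b a * q 1 + signedArea q p a * b 1 =
      -signedArea q b p * a 1 := by
    unfold signedArea; ring
  have h₁ : 0 < signedArea q p a := by
    refine pos_of_mul_pos_left (b := b 1) ?_ hb.le
    nlinarith [mul_pos hqab (neg_pos.2 hp), mul_pos hpba (neg_pos.2 hq),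
      mul_nonneg (neg_nonneg.2 hT) ha.le]
  nlinarith [mul_pos hqab (sub_pos.2 hap), mul_pos hpba (sub_pos.2 haq),
    mul_pos h₁ (sub_pos.2 hab)]

/-- The mirror image of `signedArea_pos_of_lt`. -/
theorem signedArea_neg_of_lt {c d p q : Pt} (hd : 0 < d 1) (hc : 0 < c 1) (hp : p 1 < 0)
    (hq : q 1 < 0) (hcd : c 0 < d 0) (hpd : p 0 < d 0) (hqd : q 0 < d 0)
    (hpcd : 0 < signedArea p c d) (hqdc : 0 < signedArea q d c) : signedArea p c q < 0 := by
  have := signedArea_pos_of_lt (a := !₂[-d 0, d 1]) (b := !₂[-c 0, c 1]) (p := !₂[-q 0, q 1])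
    (q := !₂[-p 0, p 1])
  simp only [signedArea, Matrix.cons_val_zero, Matrix.cons_val_one] at *
  have := this hd hc hq hp (by linarith) (by linarith) (by linarith) (by linarith) (by linarith)
  linarith

/-- Membership in the open left wedge of `q` with respect to `b` and `d`, from orientations. -/
theorem exists_left_wedge {b d p q : Pt} (hqdb : 0 < signedArea q d b)
    (hqbp : 0 < signedArea q b p) (hqdp : 0 < signedArea q d p) :
    ∃ s t : ℝ, 0 < s ∧ 0 < t ∧ p = q + s • (b - q) - t • (d - q) := by
  refine ⟨signedArea q d p / signedArea q d b, signedArea q b p / signedArea q d b,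
    div_pos hqdp hqdb, div_pos hqbp hqdb, ?_⟩
  ext n
  simp only [PiLp.add_apply, PiLp.sub_apply, PiLp.smul_apply, smul_eq_mul]
  have := hqdb.ne'
  field_simp
  unfold signedArea
  fin_cases n <;> simp <;> ring

/-- The geometric core: `p` witnesses the pair `a, c`, `q` witnesses the pair `b, d`, and neither
of them witnesses any of the remaining pairs `a, b`, `a, d`, `b, c`, `c, d`. -/
theorem exists_left_wedge_of_gabrielDisk {a b c d p q : Pt} (ha : 0 < a 1) (hb : 0 < b 1)
    (hc : 0 < c 1) (hd : 0 < d 1) (hp : p 1 < 0) (hq : q 1 < 0) (hab : a 0 < b 0)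
    (hbc : b 0 < c 0) (hcd : c 0 < d 0) (hpac : p ∈ gabrielDisk a c)
    (hqbd : q ∈ gabrielDisk b d) (hpab : p ∉ gabrielDisk a b) (hpbc : p ∉ gabrielDisk b c)
    (hpad : p ∉ gabrielDisk a d) (hpdc : p ∉ gabrielDisk d c) (hqba : q ∉ gabrielDisk b a)
    (hqad : q ∉ gabrielDisk a d) (hqbc : q ∉ gabrielDisk b c) (hqcd : q ∉ gabrielDisk c d) :
    ∃ s t : ℝ, 0 < s ∧ 0 < t ∧ p = q + s • (b - q) - t • (d - q) := by
  have pa := hp.trans ha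
  have pb := hp.trans hb
  have pc := hp.trans hc
  have pd := hp.trans hd
  have qa := hq.trans ha
  have qb := hq.trans hb
  have qc := hq.trans hc
  have qd := hq.trans hd
  obtain ⟨hap, hpc⟩ := lt_and_lt_of_not_acute pa pc (hab.trans hbc)
    ((mem_gabrielDisk_iff _ _ _).1 hpac)
  obtain ⟨hbq, hqd⟩ := lt_and_lt_of_not_acute qb qd (hbc.trans hcd)
    ((mem_gabrielDisk_iff _ _ _).1 hqbd)
  obtain ⟨hpcb, hpba⟩ := signedArea_pos_of_acute pa pb pc (hab.trans hbc) hpac hpab hpbc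
  obtain ⟨hpcd, -⟩ := signedArea_pos_of_acute pa pd pc (hab.trans hbc) hpac hpad hpdc
  obtain ⟨-, hqab⟩ := signedArea_pos_of_acute qb qa qd (hbc.trans hcd) hqbd hqba hqad
  obtain ⟨hqdc, -⟩ := signedArea_pos_of_acute qb qc qd (hbc.trans hcd) hqbd hqbc hqcd
  have hqbp := signedArea_pos_of_lt ha hb hp hq hab hap (hab.trans hbq) hqab hpba
  have hpcq := signedArea_neg_of_lt hd hc hp hq hcd (hpc.trans hcd) hqd hpcd hqdc
  have hqdb : 0 < signedArea q d b := by
    unfold signedArea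
    nlinarith [mul_pos (sub_pos.2 hqd) (sub_pos.2 qb), mul_pos (sub_pos.2 hbq) (sub_pos.2 qd)]
  refine exists_left_wedge hqdb hqbp ?_
  by_contra! hqdp
  have hq_comb : signedArea p c q * (signedArea q d b + signedArea q b p - signedArea q d p) =
      signedArea q b p * signedArea p c d + -signedArea q d p * signedArea p c b := by
    unfold signedArea; ring
  nlinarith [mul_pos hqbp hpcd, mul_nonneg (neg_nonneg.2 hqdp) hpcb.le,
    mul_neg_of_neg_of_pos hpcq
      (show 0 < signedArea q d b + signedArea q b p - signedArea q d p by linarith)]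

/-- If a map has fibers of size two and `u ≠ v` share a value, no third point has this value. -/
theorem ne_of_fiber_card_eq_two {α β : Type*} [Finite α] {c : α → β} {u v w : α}
    (hcard : Nat.card {x : α // c x = c u} = 2) (huv : u ≠ v) (hc : c u = c v) (hwu : w ≠ u)
    (hwv : w ≠ v) : c u ≠ c w := by
  intro h
  have h3 : ({u, v, w} : Set α).ncard = 3 := Set.ncard_eq_three.2
    ⟨u, v, w, huv, hwu.symm, hwv.symm, rfl⟩
  have hle : ({u, v, w} : Set α).ncard ≤ {x : α | c x = c u}.ncard := by
    refine Set.ncard_le_ncard ?_ (Set.toFinite _)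
    rintro x (rfl | rfl | rfl)
    exacts [rfl, hc.symm, h.symm]
  have : {x : α | c x = c u}.ncard = 2 := hcard
  omega

/-- Lemma 12: the witnesses of the partition classes appear in the same left-to-right
order as the classes themselves: the witness of an earlier class lies in the open left
wedge of the witness of a later class. -/
theorem stmt18 (k : ℕ) (hk : 2 ≤ k)
    (G : SimpleGraph (Fin (2 * k))) (c : Fin (2 * k) → Fin k)
    (hfib : ∀ j : Fin k, Nat.card {v : Fin (2 * k) // c v = j} = 2)
    (hG : ∀ u v : Fin (2 * k), G.Adj u v ↔ c u ≠ c v)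
    (f : Fin (2 * k) → Pt) (P : Set Pt) (hWG : IsWGDrawing G f P)
    (hx : ∀ u v : Fin (2 * k), u < v → f u 0 < f v 0)
    (hy : ∀ v, 0 < f v 1) (hP : ∀ p ∈ P, p 1 < 0)
    (hcls : ∀ i' : ℕ, (hi' : i' < k) → c ⟨i', by omega⟩ = c ⟨i' + k, by omega⟩)
    (i j : ℕ) (hij : i < j) (hjk : j < k)
    (pi pj : Pt) (hpi : pi ∈ P) (hpj : pj ∈ P)
    (hpiD : pi ∈ gabrielDisk (f ⟨i, by omega⟩) (f ⟨i + k, by omega⟩))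
    (hpjD : pj ∈ gabrielDisk (f ⟨j, by omega⟩) (f ⟨j + k, by omega⟩)) :
    ∃ s t : ℝ, 0 < s ∧ 0 < t ∧
      pi = pj + s • (f ⟨j, by omega⟩ - pj) - t • (f ⟨j + k, by omega⟩ - pj) := by
  obtain ⟨-, -, hadj⟩ := hWG
  have hi := hcls i (hij.trans hjk)
  have hj := hcls j hjk
  have hci : c ⟨i, by omega⟩ ≠ c ⟨j, by omega⟩ :=
    ne_of_fiber_card_eq_two (hfib _) (fun h => by simp at h; omega) hi
      (fun h => by simp at h; omega) (fun h => by simp at h; omega)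
  have hnot {u v : Fin (2 * k)} {p : Pt} (h : c u ≠ c v) (hp : p ∈ P) :
      p ∉ gabrielDisk (f u) (f v) := fun hpD =>
    ((hadj u v fun huv => h (congrArg c huv)).1 ((hG u v).2 h)).subset ⟨hpD, hp⟩
  apply exists_left_wedge_of_gabrielDisk (a := f ⟨i, by omega⟩) (c := f ⟨i + k, by omega⟩)
    (hy _) (hy _) (hy _) (hy _) (hP _ hpi) (hP _ hpj)
    (hx _ _ (by simp; omega)) (hx _ _ (by simp; omega)) (hx _ _ (by simp; omega))
    hpiD hpjD <;> apply hnot <;> first | assumption | (simp only [← hi, ← hj]; first | exact hci | exact hci.symm) | exact hci.symm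
end
end

section
/- Let k ≥ 2 and let f be a WG-drawing with witness set P ⊆ ℝ² of a finite complete k-partite graph G all of whose partition classes have exactly two vertices, such that every point of the image of f has strictly positive y-coordinate and every point of P has strictly negative y-coordinate. Let {u, u'} and {w, w'} be two distinct partition classes of G (so c(u) = c(u') ≠ c(w) = c(w') with u ≠ u' and w ≠ w'), and let p ∈ P with p ∈ D[f(u), f(u')]. Then p ∉ D[f(w), f(w')]; that is, no witness point can witness two different partition classes. -/
noncomputable section

/-- Two pairs of reals with products at most `-1` cannot have all cross products above `-1`. -/
theorem false_of_mul_le_neg_one {s s' t t' : ℝ} (hs : s * s' ≤ -1) (ht : t * t' ≤ -1)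
    (h₁ : -1 < s * t) (h₂ : -1 < s * t') (h₃ : -1 < s' * t) (h₄ : -1 < s' * t') : False := by
  have key : ∀ {a a' b b' : ℝ}, 0 < a → 0 < b → a * a' ≤ -1 → b * b' ≤ -1 →
      -1 < a * b' → -1 < a' * b → False := by
    intro a a' b b' ha hb haa hbb hab hba
    have ha' : a' < 0 := by nlinarith
    have hb' : b' < 0 := by nlinarith
    have hab' : a * b' < 0 := mul_neg_of_pos_of_neg ha hb'
    have hba' : a' * b < 0 := mul_neg_of_neg_of_pos ha' hb
    nlinarith [mul_nonneg (sub_nonneg.2 haa) (sub_nonneg.2 hbb)]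
  have pos_or : ∀ {a b : ℝ}, a * b ≤ -1 → 0 < a ∨ 0 < b := by
    intro a b h
    by_contra! hn
    nlinarith [mul_nonneg_of_nonpos_of_nonpos hn.1 hn.2]
  rcases pos_or hs with h | h <;> rcases pos_or ht with h' | h'
  · exact key h h' hs ht h₂ h₃
  · exact key h h' hs (by linarith) h₁ h₄
  · exact key h h' (by linarith) ht h₄ h₁
  · exact key h h' (by linarith) (by linarith) h₃ h₂

/-- Dividing the inner product of two vectors of the upper half-plane by their heights. -/
theorem div_mul_div_add_one {x y x' y' : ℝ} (hy : 0 < y) (hy' : 0 < y') :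
    x / y * (x' / y') + 1 = (x * x' + y * y') / (y * y') := by
  field_simp

/-- From Lemma 12: no witness point can witness two different partition classes of a
linearly separated WG-drawing of a complete `k`-partite graph with classes of size two. -/
theorem stmt19 {V : Type*} [Fintype V] (k : ℕ) (hk : 2 ≤ k)
    (G : SimpleGraph V) (c : V → Fin k)
    (hfib : ∀ j : Fin k, Nat.card {v : V // c v = j} = 2)
    (hG : ∀ u v : V, G.Adj u v ↔ c u ≠ c v)
    (f : V → Pt) (P : Set Pt) (hWG : IsWGDrawing G f P)
    (hy : ∀ v, 0 < f v 1) (hP : ∀ p ∈ P, p 1 < 0)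
    (u u' w w' : V) (huu' : u ≠ u') (hww' : w ≠ w')
    (hcu : c u = c u') (hcw : c w = c w') (hcl : c u ≠ c w)
    (p : Pt) (hp : p ∈ P) (hpD : p ∈ gabrielDisk (f u) (f u')) :
    p ∉ gabrielDisk (f w) (f w') := by
  intro hpD'
  have hp1 := hP p hp
  have pos : ∀ v, 0 < f v 1 - p 1 := fun v => by linarith [hy v]
  have slope_le : ∀ v v', p ∈ gabrielDisk (f v) (f v') →
      (f v 0 - p 0) / (f v 1 - p 1) * ((f v' 0 - p 0) / (f v' 1 - p 1)) ≤ -1 := by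
    intro v v' h
    have := div_nonpos_of_nonpos_of_nonneg ((mem_gabrielDisk_iff _ _ _).1 h)
      (mul_pos (pos v) (pos v')).le
    rw [← div_mul_div_add_one (pos v) (pos v')] at this
    linarith
  have lt_slope : ∀ v v', c v ≠ c v' →
      -1 < (f v 0 - p 0) / (f v 1 - p 1) * ((f v' 0 - p 0) / (f v' 1 - p 1)) := by
    intro v v' h
    have hempty := (hWG.2.2 v v' (ne_of_apply_ne c h)).1 ((hG v v').2 h)
    have hnot : p ∉ gabrielDisk (f v) (f v') := fun hmem =>
      Set.notMem_empty p (hempty ▸ ⟨hmem, hp⟩)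
    rw [mem_gabrielDisk_iff, not_le] at hnot
    have := div_pos hnot (mul_pos (pos v) (pos v'))
    rw [← div_mul_div_add_one (pos v) (pos v')] at this
    linarith
  exact false_of_mul_le_neg_one (slope_le u u' hpD) (slope_le w w' hpD')
    (lt_slope u w hcl) (lt_slope u w' (hcw ▸ hcl)) (lt_slope u' w (hcu ▸ hcl))
    (lt_slope u' w' (hcu ▸ hcw ▸ hcl))
end
end
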